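/- arXiv:1101.4182 — 7 statements merged into one kernel-verified Lean document; each statement's English description precedes it below -/
import Mathlib

section
/- Let D ≥ 3, let i be an element of the (D+1)-element set C = {0,…,D}, and let ω be a cyclic permutation of î := C ∖ {i}. Then the number of equivalence classes {τ, τ⁻¹} of cyclic permutations τ of C such that the cyclic permutation of î induced by τ (obtained by deleting i from the cycle of τ, i.e., the permutation ω' of î with ω'(c) = τ(c) for τ(c) ≠ i and ω'(τ⁻¹(i)) = τ(i)) equals ω or ω⁻¹, is exactly D. In other words, every jacket of a D-bubble of a bipartite (D+1)-colored graph is obtained from exactly D jackets of the graph. -/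
/-- A cyclic permutation of a finite set: a permutation with a single cycle
covering all of the set. -/
def IsFullCycle {α : Type*} [Fintype α] [DecidableEq α] (τ : Equiv.Perm α) : Prop :=
  τ.IsCycle ∧ τ.support = Finset.univ

/-- `InducedEq i τ ω` says that the cyclic permutation of `î = {0,…,D} \ {i}` induced
by `τ` (obtained by deleting `i` from the cycle of `τ`: it sends `c` to `τ c` when
`τ c ≠ i`, and sends `τ⁻¹ i` to `τ i`) equals `ω`. -/
def InducedEq {D : ℕ} (i : Fin (D + 1)) (τ : Equiv.Perm (Fin (D + 1)))
    (ω : Equiv.Perm {x : Fin (D + 1) // x ≠ i}) : Prop :=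
  ∀ c : {x : Fin (D + 1) // x ≠ i},
    (ω c : Fin (D + 1)) =
      if τ (c : Fin (D + 1)) = i then τ (τ (c : Fin (D + 1))) else τ (c : Fin (D + 1))

theorem InducedEq.inv {D : ℕ} {i : Fin (D + 1)} {τ : Equiv.Perm (Fin (D + 1))}
    {ω : Equiv.Perm {x : Fin (D + 1) // x ≠ i}} (h : InducedEq i τ ω) :
    InducedEq i τ⁻¹ ω⁻¹ := by
  intro c
  obtain ⟨d, rfl⟩ := ω.surjective c
  have hd := h d
  have hinv : ∀ x, τ⁻¹ (τ x) = x := τ.symm_apply_apply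
  rw [show ω⁻¹ (ω d) = d from ω.symm_apply_apply d]
  split_ifs at hd with h1
  · rw [hd, hinv, if_pos h1, hinv]
  · rw [hd, hinv, if_neg d.2]

theorem InducedEq.right_unique {D : ℕ} {i : Fin (D + 1)} {τ : Equiv.Perm (Fin (D + 1))}
    {ω ω' : Equiv.Perm {x : Fin (D + 1) // x ≠ i}} (h : InducedEq i τ ω)
    (h' : InducedEq i τ ω') : ω = ω' :=
  Equiv.ext fun c => Subtype.ext ((h c).trans (h' c).symm)

theorem InducedEq.sameCycle {D : ℕ} {i : Fin (D + 1)} {τ : Equiv.Perm (Fin (D + 1))}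
    {ω : Equiv.Perm {x : Fin (D + 1) // x ≠ i}} (h : InducedEq i τ ω)
    {x y : {x : Fin (D + 1) // x ≠ i}} (hxy : ω.SameCycle x y) :
    τ.SameCycle (x : Fin (D + 1)) y := by
  obtain ⟨n, -, rfl⟩ := hxy.exists_pow_eq'
  clear hxy
  induction n with
  | zero => exact Equiv.Perm.SameCycle.refl _ _
  | succ n ih =>
    rw [pow_succ', Equiv.Perm.mul_apply, h]
    split_ifs
    · exact Equiv.Perm.sameCycle_apply_right.2 (Equiv.Perm.sameCycle_apply_right.2 ih)
    · exact Equiv.Perm.sameCycle_apply_right.2 ih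

/-- The permutation obtained from `ω` by inserting `i` in its cycle right after `c`. -/
def insertAfter {D : ℕ} {i : Fin (D + 1)} (ω : Equiv.Perm {x : Fin (D + 1) // x ≠ i})
    (c : {x : Fin (D + 1) // x ≠ i}) : Equiv.Perm (Fin (D + 1)) :=
  Equiv.Perm.ofSubtype ω * Equiv.swap (c : Fin (D + 1)) i

section insertAfter

variable {D : ℕ} {i : Fin (D + 1)} (ω : Equiv.Perm {x : Fin (D + 1) // x ≠ i})
  (c : {x : Fin (D + 1) // x ≠ i})

theorem insertAfter_apply_self : insertAfter ω c c = i := by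
  rw [insertAfter, Equiv.Perm.mul_apply, Equiv.swap_apply_left,
    Equiv.Perm.ofSubtype_apply_of_not_mem ω (by simp)]

theorem insertAfter_apply_new : insertAfter ω c i = ω c := by
  rw [insertAfter, Equiv.Perm.mul_apply, Equiv.swap_apply_right, Equiv.Perm.ofSubtype_apply_coe]

theorem insertAfter_apply_of_ne {x : {x : Fin (D + 1) // x ≠ i}} (hx : x ≠ c) :
    insertAfter ω c x = ω x := by
  rw [insertAfter, Equiv.Perm.mul_apply,
    Equiv.swap_apply_of_ne_of_ne (fun h => hx (Subtype.ext h)) x.2,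
    Equiv.Perm.ofSubtype_apply_coe]

theorem insertAfter_injective : Function.Injective (insertAfter ω) := by
  intro c d h
  have hc := insertAfter_apply_self ω c
  rw [h] at hc
  exact Subtype.ext ((insertAfter ω d).injective (hc.trans (insertAfter_apply_self ω d).symm))

theorem inducedEq_insertAfter : InducedEq i (insertAfter ω c) ω := by
  intro x
  by_cases hx : x = c
  · rw [hx, insertAfter_apply_self, if_pos rfl, insertAfter_apply_new]
  · rw [insertAfter_apply_of_ne ω c hx, if_neg (ω x).2]

variable {ω}

theorem isFullCycle_insertAfter (hω : IsFullCycle ω) : IsFullCycle (insertAfter ω c) := by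
  have hne : ∀ x, ω x ≠ x := fun x =>
    Equiv.Perm.mem_support.1 (hω.2 ▸ Finset.mem_univ x)
  have hsame : ∀ x, (insertAfter ω c).SameCycle i x := by
    have hc : (insertAfter ω c).SameCycle i c := by
      rw [← Equiv.Perm.sameCycle_apply_right, insertAfter_apply_self]
    intro x
    by_cases hx : x = i
    · rw [hx]
    · exact hc.trans ((inducedEq_insertAfter ω c).sameCycle
        (y := ⟨x, hx⟩) (hω.1.sameCycle (hne c) (hne _)))
  refine ⟨⟨i, ?_, fun x _ => hsame x⟩, ?_⟩
  · rw [insertAfter_apply_new]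
    exact (ω c).2
  · refine Finset.eq_univ_of_forall fun x => Equiv.Perm.mem_support.2 fun hx => ?_
    by_cases hxi : x = i
    · rw [hxi, insertAfter_apply_new] at hx
      exact (ω c).2 hx
    · lift x to {x : Fin (D + 1) // x ≠ i} using hxi
      by_cases hxc : x = c
      · rw [hxc, insertAfter_apply_self] at hx
        exact c.2 hx.symm
      · rw [insertAfter_apply_of_ne ω c hxc] at hx
        exact hne x (Subtype.ext hx)

theorem InducedEq.exists_eq_insertAfter {τ : Equiv.Perm (Fin (D + 1))}
    (hτ : IsFullCycle τ) (h : InducedEq i τ ω) : ∃ c, τ = insertAfter ω c := by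
  obtain ⟨c, hc⟩ := τ.surjective i
  have hci : c ≠ i := by
    rintro rfl
    exact Equiv.Perm.mem_support.1 (hτ.2 ▸ Finset.mem_univ c) hc
  lift c to {x : Fin (D + 1) // x ≠ i} using hci
  refine ⟨c, Equiv.ext fun x => ?_⟩
  by_cases hxi : x = i
  · rw [hxi, insertAfter_apply_new, h, if_pos hc, hc]
  · lift x to {x : Fin (D + 1) // x ≠ i} using hxi
    by_cases hxc : x = c
    · rw [hxc, insertAfter_apply_self, hc]
    · rw [insertAfter_apply_of_ne ω c hxc, h, if_neg]
      exact fun hx => hxc (Subtype.ext (τ.injective (hx.trans hc.symm)))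

end insertAfter

theorem IsFullCycle.orderOf_eq {α : Type*} [Fintype α] [DecidableEq α] {ω : Equiv.Perm α}
    (hω : IsFullCycle ω) : orderOf ω = Fintype.card α := by
  rw [hω.1.orderOf, hω.2, Finset.card_univ]

theorem IsFullCycle.ne_inv {α : Type*} [Fintype α] [DecidableEq α] {ω : Equiv.Perm α}
    (hω : IsFullCycle ω) (hα : 2 < Fintype.card α) : ω ≠ ω⁻¹ := by
  intro h
  have hsq : ω ^ 2 = 1 := by
    rw [pow_two]
    exact mul_eq_one_iff_eq_inv.2 h
  have hle := orderOf_le_of_pow_eq_one two_pos hsq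
  rw [hω.orderOf_eq] at hle
  omega

/-- Let `D ≥ 3`, let `i` be a color in `{0,…,D}` and let `ω` be a cyclic permutation of
`î = {0,…,D} \ {i}`.  The number of classes `{τ, τ⁻¹}` of cyclic permutations `τ` of
`{0,…,D}` whose induced cyclic permutation of `î` is `ω` or `ω⁻¹` is exactly `D`:
every jacket of a `D`-bubble is obtained from exactly `D` jackets of the graph. -/
theorem numberOfJacketsInducingBubbleJacket (D : ℕ) (hD : 3 ≤ D) (i : Fin (D + 1))
    (ω : Equiv.Perm {x : Fin (D + 1) // x ≠ i}) (hω : IsFullCycle ω) :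
    Nat.card {s : Set (Equiv.Perm (Fin (D + 1))) |
      ∃ τ : Equiv.Perm (Fin (D + 1)), IsFullCycle τ ∧
        (InducedEq i τ ω ∨ InducedEq i τ ω⁻¹) ∧ s = {τ, τ⁻¹}} = D := by
  have hcard : Fintype.card {x : Fin (D + 1) // x ≠ i} = D := by
    simp
  have hinj : Function.Injective
      fun c => ({insertAfter ω c, (insertAfter ω c)⁻¹} : Set (Equiv.Perm (Fin (D + 1)))) := by
    intro c d hcd
    have hmem : insertAfter ω c ∈
        ({insertAfter ω d, (insertAfter ω d)⁻¹} : Set (Equiv.Perm (Fin (D + 1)))) :=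
      hcd.subset (Set.mem_insert _ _)
    rcases hmem with h | h
    · exact insertAfter_injective ω h
    · have hd := (inducedEq_insertAfter ω d).inv
      rw [← Set.mem_singleton_iff.1 h] at hd
      exact absurd ((inducedEq_insertAfter ω c).right_unique hd) (hω.ne_inv (by omega))
  have hrange : {s : Set (Equiv.Perm (Fin (D + 1))) |
      ∃ τ : Equiv.Perm (Fin (D + 1)), IsFullCycle τ ∧
        (InducedEq i τ ω ∨ InducedEq i τ ω⁻¹) ∧ s = {τ, τ⁻¹}} =
      Set.range fun c => {insertAfter ω c, (insertAfter ω c)⁻¹} := by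
    ext s
    constructor
    · rintro ⟨τ, hτ, h | h, rfl⟩
      · obtain ⟨c, rfl⟩ := h.exists_eq_insertAfter hτ
        exact ⟨c, rfl⟩
      · have h' := h.inv
        rw [inv_inv] at h'
        obtain ⟨c, hc⟩ := h'.exists_eq_insertAfter
          ⟨hτ.1.inv, (Equiv.Perm.support_inv τ).trans hτ.2⟩
        refine ⟨c, ?_⟩
        simp only [← hc, inv_inv]
        exact Set.pair_comm _ _
    · rintro ⟨c, rfl⟩
      exact ⟨_, isFullCycle_insertAfter c hω, Or.inl (inducedEq_insertAfter ω c), rfl⟩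
  rw [hrange, Nat.card_range_of_injective hinj, Nat.card_eq_fintype_card, hcard]
end

section
/- Let D ≥ 2 and let G be a bipartite (D+1)-colored graph with p black vertices. Then for every jacket J of G the Euler characteristic χ_J := 2p − (D+1)p + F_J is an even integer; equivalently, F_J ≡ (D−1)p (mod 2). -/
noncomputable section
/-- The cycle (orbit) of `π` through `b`, as a set. -/
def cycleSet {B : Type*} (π : Equiv.Perm B) (b : B) : Set B :=
  {x | π.SameCycle b x}

/-- The cycles of `π` passing through the set `s` (for a `π`-invariant `s`, these are
the cycles of the restriction of `π` to `s`). -/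
def cyclesIn {B : Type*} (π : Equiv.Perm B) (s : Set B) : Set (Set B) :=
  {t | ∃ b ∈ s, t = cycleSet π b}

/-- The number of cycles of `π` passing through `s`. -/
def numCyclesIn {B : Type*} (π : Equiv.Perm B) (s : Set B) : ℕ :=
  Nat.card (cyclesIn π s)

/-- The number of cycles (orbits, including fixed points) of `π`. -/
def numCycles {B : Type*} (π : Equiv.Perm B) : ℕ :=
  numCyclesIn π Set.univ

/-- A bipartite `(D+1)`-colored graph on black vertices `B` and white vertices `W`
is a family `σ : Fin (D+1) → B ≃ W` of bijections (the edges of each color).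
`facePerm σ i j = σ_j⁻¹ ∘ σ_i` is the permutation of `B` whose cycles are the
faces of colors `{i, j}`. -/
def facePerm {D : ℕ} {B W : Type*} (σ : Fin (D + 1) → B ≃ W) (i j : Fin (D + 1)) :
    Equiv.Perm B :=
  (σ i).trans (σ j).symm

/-- The number of faces of the jacket associated to a cyclic permutation `τ` of the
colors: the faces of colors `{c, τ c}` for all colors `c`. -/
def jacketFaces {D : ℕ} {B W : Type*} (σ : Fin (D + 1) → B ≃ W)
    (τ : Equiv.Perm (Fin (D + 1))) : ℕ :=
  ∑ c : Fin (D + 1), numCycles (facePerm σ c (τ c))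

/-- The total number of faces of the graph, over all unordered pairs of distinct colors. -/
def totalFaces {D : ℕ} {B W : Type*} (σ : Fin (D + 1) → B ≃ W) : ℕ :=
  ∑ p ∈ Finset.univ.filter (fun p : Fin (D + 1) × Fin (D + 1) => p.1 < p.2),
    numCycles (facePerm σ p.1 p.2)

/-- The subgroup of permutations of `B` generated by all `σ_j⁻¹ ∘ σ_i`. -/
def colorGroup {D : ℕ} {B W : Type*} (σ : Fin (D + 1) → B ≃ W) : Subgroup (Equiv.Perm B) :=
  Subgroup.closure {π | ∃ i j, π = facePerm σ i j}

/-- The graph is connected iff the group generated by the `σ_j⁻¹ ∘ σ_i` acts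
transitively on `B`. -/
def IsConnectedGraph {D : ℕ} {B W : Type*} (σ : Fin (D + 1) → B ≃ W) : Prop :=
  ∀ b b' : B, ∃ g ∈ colorGroup σ, g b = b'

/-- The subgroup generated by the `σ_k⁻¹ ∘ σ_j` with `j, k ≠ i`. -/
def bubbleGroup {D : ℕ} {B W : Type*} (σ : Fin (D + 1) → B ≃ W) (i : Fin (D + 1)) :
    Subgroup (Equiv.Perm B) :=
  Subgroup.closure {π | ∃ j k, j ≠ i ∧ k ≠ i ∧ π = facePerm σ j k}

/-- The `D`-bubble of colors `î` containing the black vertex `b`: its orbit under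
`bubbleGroup σ i`. -/
def bubbleOf {D : ℕ} {B W : Type*} (σ : Fin (D + 1) → B ≃ W) (i : Fin (D + 1)) (b : B) :
    Set B :=
  {x | ∃ g ∈ bubbleGroup σ i, g b = x}

/-- The set of `D`-bubbles of colors `î` of the graph. -/
def bubbles {D : ℕ} {B W : Type*} (σ : Fin (D + 1) → B ≃ W) (i : Fin (D + 1)) :
    Set (Set B) :=
  {s | ∃ b, s = bubbleOf σ i b}

theorem cycleSet_of_mem_support {B : Type*} [Fintype B] [DecidableEq B] {π : Equiv.Perm B} {b : B}
    (hb : b ∈ π.support) : cycleSet π b = ((π.cycleOf b).support : Set B) := by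
  ext x
  simp only [cycleSet, Set.mem_ofPred_eq, Finset.mem_coe, Equiv.Perm.mem_support_cycleOf_iff]
  exact ⟨fun h => ⟨h, hb⟩, fun h => h.1⟩

theorem cycleSet_of_notMem_support {B : Type*} [Fintype B] [DecidableEq B] {π : Equiv.Perm B}
    {b : B} (hb : b ∉ π.support) : cycleSet π b = {b} := by
  have hfix : Function.IsFixedPt π b := Equiv.Perm.notMem_support.mp hb
  ext x
  refine ⟨fun h => ?_, fun h => ?_⟩
  · exact (Equiv.Perm.SameCycle.eq_of_left h hfix).symm
  · rw [Set.mem_singleton_iff.mp h]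
    exact Equiv.Perm.SameCycle.refl π b

theorem image_cycleSet_support {B : Type*} [Fintype B] [DecidableEq B] (π : Equiv.Perm B) :
    cycleSet π '' (π.support : Set B) =
      (fun c : Equiv.Perm B => (c.support : Set B)) '' (π.cycleFactorsFinset : Set _) := by
  ext t
  constructor
  · rintro ⟨b, hb, rfl⟩
    exact ⟨π.cycleOf b, Equiv.Perm.cycleOf_mem_cycleFactorsFinset_iff.mpr hb,
      (cycleSet_of_mem_support hb).symm⟩
  · rintro ⟨c, hc, rfl⟩
    obtain ⟨b, hb⟩ := (Equiv.Perm.mem_cycleFactorsFinset_iff.mp hc).1.nonempty_support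
    have hbπ : b ∈ π.support := Equiv.Perm.mem_cycleFactorsFinset_support_le hc hb
    refine ⟨b, hbπ, ?_⟩
    rw [cycleSet_of_mem_support hbπ, ← Equiv.Perm.cycle_is_cycleOf hb hc]

theorem injOn_support_cycleFactorsFinset {B : Type*} [Fintype B] [DecidableEq B]
    (π : Equiv.Perm B) :
    Set.InjOn (fun c : Equiv.Perm B => (c.support : Set B)) (π.cycleFactorsFinset : Set _) := by
  intro c hc d hd h
  obtain ⟨b, hb⟩ := (Equiv.Perm.mem_cycleFactorsFinset_iff.mp hc).1.nonempty_support
  have hbd : b ∈ d.support := by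
    rw [← Finset.coe_injective h]
    exact hb
  rw [Equiv.Perm.cycle_is_cycleOf hb hc, ← Equiv.Perm.cycle_is_cycleOf hbd hd]

/-- The number of orbits is the number of nontrivial cycles plus the number of fixed points. -/
theorem numCycles_eq {B : Type*} [Fintype B] [DecidableEq B] (π : Equiv.Perm B) :
    numCycles π = π.cycleFactorsFinset.card + π.supportᶜ.card := by
  have hsplit : cyclesIn π Set.univ =
      cycleSet π '' (π.support : Set B) ∪ cycleSet π '' (π.supportᶜ : Finset B) := by
    rw [← Set.image_union, Finset.coe_compl, Set.union_compl_self]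
    ext t
    simp [cyclesIn, eq_comm]
  have hdisj : Disjoint (cycleSet π '' (π.support : Set B))
      (cycleSet π '' (π.supportᶜ : Finset B)) := by
    rw [Set.disjoint_left]
    rintro _ ⟨a, ha, rfl⟩ ⟨b, hb, hab⟩
    rw [cycleSet_of_notMem_support (Finset.mem_compl.mp hb)] at hab
    have hmem : a ∈ cycleSet π a := Equiv.Perm.SameCycle.refl π a
    rw [← hab, Set.mem_singleton_iff] at hmem
    exact Finset.mem_compl.mp hb (hmem ▸ ha)
  have hinj : Set.InjOn (cycleSet π) (π.supportᶜ : Finset B) := by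
    intro a ha b hb hab
    rwa [cycleSet_of_notMem_support (Finset.mem_compl.mp ha),
      cycleSet_of_notMem_support (Finset.mem_compl.mp hb), Set.singleton_eq_singleton_iff] at hab
  rw [numCycles, numCyclesIn, Nat.card_coe_set_eq, hsplit,
    Set.ncard_union_eq hdisj (Set.toFinite _) (Set.toFinite _), hinj.ncard_image,
    image_cycleSet_support, (injOn_support_cycleFactorsFinset π).ncard_image,
    Set.ncard_coe_finset, Set.ncard_coe_finset]

/-- The sign of a permutation in terms of its number of orbits. -/
theorem sign_eq_neg_one_pow_card_add_numCycles {B : Type*} [Fintype B] [DecidableEq B]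
    (π : Equiv.Perm B) :
    Equiv.Perm.sign π = (-1) ^ (Fintype.card B + numCycles π) := by
  have hcard : π.cycleType.card = π.cycleFactorsFinset.card := by
    simp [Equiv.Perm.cycleType_def]
  have hcompl : π.support.card + π.supportᶜ.card = Fintype.card B :=
    Finset.card_add_card_compl _
  rw [Equiv.Perm.sign_of_cycleType, Equiv.Perm.sum_cycleType, hcard, numCycles_eq, ← hcompl,
    show π.support.card + π.supportᶜ.card + (π.cycleFactorsFinset.card + π.supportᶜ.card) =
      π.support.card + π.cycleFactorsFinset.card + 2 * π.supportᶜ.card by ring,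
    pow_add _ _ (2 * _), pow_mul]
  simp

/-- The signs of the face permutations along any permutation of the colors multiply to `1`. -/
theorem prod_sign_facePerm {D : ℕ} {B W : Type*} [Fintype B] [DecidableEq B]
    (σ : Fin (D + 1) → B ≃ W) (τ : Equiv.Perm (Fin (D + 1))) :
    ∏ c, Equiv.Perm.sign (facePerm σ c (τ c)) = 1 := by
  have hsign (i j : Fin (D + 1)) : Equiv.Perm.sign (facePerm σ i j) =
      Equiv.Perm.sign (facePerm σ i 0) * Equiv.Perm.sign (facePerm σ j 0) := by
    rw [show facePerm σ i j = (facePerm σ j 0)⁻¹ * facePerm σ i 0 by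
      rw [eq_inv_mul_iff_mul_eq]
      ext b
      simp [facePerm], Equiv.Perm.sign_mul, Equiv.Perm.sign_inv, mul_comm]
  simp_rw [hsign _ (τ _)]
  rw [Finset.prod_mul_distrib, Equiv.prod_comp τ fun c => Equiv.Perm.sign (facePerm σ c 0),
    Int.units_mul_self]

/-- For a bipartite `(D+1)`-colored graph with `p` black vertices and any jacket `J`,
the Euler characteristic `χ_J = 2p - (D+1)p + F_J` is even. -/
theorem jacket_euler_char_even (D : ℕ) (hD : 2 ≤ D) (B W : Type)
    [Fintype B] [DecidableEq B] [Nonempty B] (σ : Fin (D + 1) → B ≃ W)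
    (τ : Equiv.Perm (Fin (D + 1))) (hτ : IsFullCycle τ) :
    Even (2 * (Fintype.card B : ℤ) - (D + 1) * (Fintype.card B : ℤ) +
      (jacketFaces σ τ : ℤ)) := by
  have hprod := prod_sign_facePerm σ τ
  simp_rw [sign_eq_neg_one_pow_card_add_numCycles] at hprod
  rw [Finset.prod_pow_eq_pow_sum, Finset.sum_add_distrib, Finset.sum_const, Finset.card_univ,
    Fintype.card_fin, smul_eq_mul] at hprod
  have heven : Even ((D + 1) * Fintype.card B + jacketFaces σ τ) := by
    rw [← neg_one_pow_eq_one_iff_even (R := ℤ) (by decide)]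
    simpa [jacketFaces] using congrArg Units.val hprod
  obtain ⟨k, hk⟩ := heven
  refine ⟨Fintype.card B - (D + 1) * Fintype.card B + k, ?_⟩
  zify at hk
  linear_combination hk
end
end

section
/- Let D ≥ 2 and let G be a connected bipartite (D+1)-colored graph with p black vertices. Then every jacket J of G satisfies χ_J := 2p − (D+1)p + F_J ≤ 2; equivalently F_J ≤ (D−1)p + 2, i.e., the genus g_J := (2 − χ_J)/2 of every jacket is a nonnegative (half-)integer. -/
noncomputable section
/-- The operator `f ↦ f ∘ π - f` on rational functions. -/
def permDiff {B : Type*} (π : Equiv.Perm B) : (B → ℚ) →ₗ[ℚ] (B → ℚ) :=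
  LinearMap.funLeft ℚ ℚ π - LinearMap.id

theorem permDiff_apply {B : Type*} (π : Equiv.Perm B) (f : B → ℚ) (b : B) :
    permDiff π f b = f (π b) - f b := rfl

/-- Functions on the set of cycles give `π`-invariant functions. -/
theorem numCycles_le_finrank_ker_permDiff {B : Type*} [Finite B] (π : Equiv.Perm B) :
    numCycles π ≤ Module.finrank ℚ (LinearMap.ker (permDiff π)) := by
  classical
  let q : B → cyclesIn π Set.univ := fun b => ⟨cycleSet π b, b, trivial, rfl⟩
  have hq : Function.Surjective q := by
    rintro ⟨t, b, -, rfl⟩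
    exact ⟨b, rfl⟩
  have hqπ (b : B) : q (π b) = q b := by
    refine Subtype.ext (Set.ext fun x => ?_)
    exact Equiv.Perm.sameCycle_apply_left
  have : Finite (cyclesIn π Set.univ) := Finite.of_surjective q hq
  have := Fintype.ofFinite (cyclesIn π Set.univ)
  let Φ : (cyclesIn π Set.univ → ℚ) →ₗ[ℚ] LinearMap.ker (permDiff π) :=
    (LinearMap.funLeft ℚ ℚ q).codRestrict _ fun φ => by
      rw [LinearMap.mem_ker]
      ext b
      simp [permDiff_apply, LinearMap.funLeft_apply, hqπ]
  have hΦ : Function.Injective Φ := fun φ ψ h =>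
    LinearMap.funLeft_injective_of_surjective ℚ ℚ q hq (congrArg Subtype.val h)
  have h := LinearMap.finrank_le_finrank_of_injective hΦ
  rwa [Module.finrank_fintype_fun_eq_card, ← Nat.card_eq_fintype_card] at h

theorem finrank_range_permDiff_add_numCycles_le {B : Type*} [Fintype B] (π : Equiv.Perm B) :
    Module.finrank ℚ (LinearMap.range (permDiff π)) + numCycles π ≤ Fintype.card B := by
  have h := (permDiff π).finrank_range_add_finrank_ker
  rw [Module.finrank_fintype_fun_eq_card] at h
  have := numCycles_le_finrank_ker_permDiff π
  omega

/-- A submodule containing the range of `permDiff π` for all generators `π` of a transitive group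
has codimension at most one. -/
theorem card_le_finrank_add_one_of_transitive {B : Type*} [Fintype B] [Nonempty B]
    {S : Set (Equiv.Perm B)} (hS : ∀ b b' : B, ∃ g ∈ Subgroup.closure S, g b = b')
    (E : Submodule ℚ (B → ℚ)) (hE : ∀ π ∈ S, ∀ f, permDiff π f ∈ E) :
    Fintype.card B ≤ Module.finrank ℚ E + 1 := by
  classical
  have hcl : ∀ g ∈ Subgroup.closure S, ∀ f, permDiff g f ∈ E := by
    intro g hg
    induction hg using Subgroup.closure_induction with
    | mem π hπ => exact hE π hπ
    | one =>
      intro f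
      convert E.zero_mem
      ext b
      simp [permDiff_apply]
    | mul g h _ _ ihg ihh =>
      intro f
      convert E.add_mem (ihh (f ∘ g)) (ihg f) using 1
      ext b
      simp [permDiff_apply]
    | inv g _ ih =>
      intro f
      convert E.neg_mem (ih (f ∘ ⇑g⁻¹)) using 1
      ext b
      simp [permDiff_apply]
  obtain ⟨b₀⟩ := ‹Nonempty B›
  let v : B → ℚ := Pi.single b₀ 1
  have htop : E ⊔ Submodule.span ℚ {v} = ⊤ := by
    rw [eq_top_iff, ← (Pi.basisFun ℚ B).span_eq, Submodule.span_le]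
    rintro _ ⟨b, rfl⟩
    obtain ⟨g, hg, hgb⟩ := hS b b₀
    have h : (Pi.basisFun ℚ B) b = permDiff g v + v := by
      ext x
      have : g x = b₀ ↔ x = b := by rw [← hgb, g.injective.eq_iff]
      simp [permDiff_apply, v, Pi.single_apply, this]
    rw [h]
    exact Submodule.add_mem_sup (hcl g hg v) (Submodule.mem_span_singleton_self v)
  have h1 := Submodule.finrank_add_le_finrank_add_finrank E (Submodule.span ℚ {v})
  have h2 : Module.finrank ℚ (Submodule.span ℚ {v}) ≤ 1 := by
    simpa using finrank_span_le_card (R := ℚ) ({v} : Set (B → ℚ))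
  rw [htop, finrank_top, Module.finrank_fintype_fun_eq_card] at h1
  omega

theorem IsFullCycle.exists_pow_apply_eq {α : Type*} [Fintype α] [DecidableEq α]
    {τ : Equiv.Perm α} (hτ : IsFullCycle τ) (i j : α) : ∃ n : ℕ, (τ ^ n) i = j := by
  have hne (x : α) : τ x ≠ x := by
    rw [← Equiv.Perm.mem_support, hτ.2]
    exact Finset.mem_univ x
  exact hτ.1.exists_pow_eq (hne i) (hne j)

/-- The faces of a jacket generate the whole color group. -/
theorem colorGroup_le_closure_jacket {D : ℕ} {B W : Type*} (σ : Fin (D + 1) → B ≃ W)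
    {τ : Equiv.Perm (Fin (D + 1))} (hτ : IsFullCycle τ) :
    colorGroup σ ≤ Subgroup.closure (Set.range fun c => facePerm σ c (τ c)) := by
  refine (Subgroup.closure_le _).2 ?_
  rintro _ ⟨i, j, rfl⟩
  obtain ⟨n, rfl⟩ := hτ.exists_pow_apply_eq i j
  induction n with
  | zero =>
    have h : facePerm σ i ((τ ^ 0) i) = 1 := by
      ext b
      simp [facePerm]
    rw [h]
    exact Subgroup.one_mem _
  | succ n ih =>
    have h : facePerm σ i ((τ ^ (n + 1)) i) =
        facePerm σ ((τ ^ n) i) (τ ((τ ^ n) i)) * facePerm σ i ((τ ^ n) i) := by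
      ext b
      simp [facePerm, pow_succ']
    rw [h]
    exact Subgroup.mul_mem _ (Subgroup.subset_closure ⟨(τ ^ n) i, rfl⟩) ih

/-- The map sending a function `h` on white vertices to the family of differences
`h ∘ σ c - h ∘ σ (τ c)`. -/
def jacketDiff {D : ℕ} {B W : Type*} (σ : Fin (D + 1) → B ≃ W) (τ : Equiv.Perm (Fin (D + 1))) :
    (W → ℚ) →ₗ[ℚ] ∀ c, LinearMap.range (permDiff (facePerm σ c (τ c))) :=
  LinearMap.pi fun c =>
    (LinearMap.funLeft ℚ ℚ (σ c) - LinearMap.funLeft ℚ ℚ (σ (τ c))).codRestrict _ fun h =>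
      ⟨h ∘ σ (τ c), by
        ext b
        simp [permDiff_apply, facePerm, LinearMap.funLeft_apply]⟩

theorem jacketDiff_apply {D : ℕ} {B W : Type*} (σ : Fin (D + 1) → B ≃ W)
    (τ : Equiv.Perm (Fin (D + 1))) (h : W → ℚ) (c : Fin (D + 1)) (b : B) :
    (jacketDiff σ τ h c : B → ℚ) b = h (σ c b) - h (σ (τ c) b) := rfl

theorem finrank_ker_jacketDiff_le_one {D : ℕ} {B W : Type*} [Nonempty B]
    (σ : Fin (D + 1) → B ≃ W) (hconn : IsConnectedGraph σ)
    {τ : Equiv.Perm (Fin (D + 1))} (hτ : IsFullCycle τ) :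
    Module.finrank ℚ (LinearMap.ker (jacketDiff σ τ)) ≤ 1 := by
  classical
  have hle : LinearMap.ker (jacketDiff σ τ) ≤ Submodule.span ℚ {fun _ => 1} := by
    intro h hh
    rw [LinearMap.mem_ker] at hh
    have hstep (c : Fin (D + 1)) (b : B) : h (σ (τ c) b) = h (σ c b) := by
      have := jacketDiff_apply σ τ h c b
      rw [hh] at this
      simp only [Pi.zero_apply, ZeroMemClass.coe_zero] at this
      linarith
    have hpow (n : ℕ) (c : Fin (D + 1)) (b : B) : h (σ ((τ ^ n) c) b) = h (σ c b) := by
      induction n with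
      | zero => simp
      | succ n ih => rw [pow_succ', Equiv.Perm.mul_apply, hstep, ih]
    have hcol (i j : Fin (D + 1)) (b : B) : h (σ i b) = h (σ j b) := by
      obtain ⟨n, rfl⟩ := hτ.exists_pow_apply_eq j i
      exact hpow n j b
    have hinv : ∀ g ∈ colorGroup σ, ∀ b, h (σ 0 (g b)) = h (σ 0 b) := by
      intro g hg
      induction hg using Subgroup.closure_induction with
      | mem π hπ =>
        obtain ⟨i, j, rfl⟩ := hπ
        intro b
        rw [hcol 0 j, hcol 0 i]
        simp [facePerm]
      | one => simp
      | mul g k _ _ ihg ihk =>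
        intro b
        rw [Equiv.Perm.mul_apply, ihg, ihk]
      | inv g _ ih =>
        intro b
        rw [← ih]
        simp
    obtain ⟨b₀⟩ := ‹Nonempty B›
    refine Submodule.mem_span_singleton.2 ⟨h (σ 0 b₀), ?_⟩
    ext w
    obtain ⟨g, hg, hgb⟩ := hconn b₀ ((σ 0).symm w)
    have := hinv g hg b₀
    rw [hgb, Equiv.apply_symm_apply] at this
    simp [this]
  refine (Submodule.finrank_mono hle).trans ?_
  simpa using finrank_span_le_card (R := ℚ) ({fun _ => 1} : Set (W → ℚ))

/-- For a connected bipartite `(D+1)`-colored graph with `p` black vertices, every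
jacket `J` satisfies `χ_J = 2p - (D+1)p + F_J ≤ 2`, i.e. its genus is nonnegative. -/
theorem jacket_euler_char_le_two (D : ℕ) (hD : 2 ≤ D) (B W : Type)
    [Fintype B] [DecidableEq B] [Nonempty B] (σ : Fin (D + 1) → B ≃ W)
    (hconn : IsConnectedGraph σ)
    (τ : Equiv.Perm (Fin (D + 1))) (hτ : IsFullCycle τ) :
    2 * (Fintype.card B : ℤ) - (D + 1) * (Fintype.card B : ℤ) +
      (jacketFaces σ τ : ℤ) ≤ 2 := by
  have : Fintype W := Fintype.ofEquiv B (σ 0)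
  let R (c : Fin (D + 1)) := LinearMap.range (permDiff (facePerm σ c (τ c)))
  let δ : (∀ c, R c) →ₗ[ℚ] (B → ℚ) := ∑ c, (R c).subtype ∘ₗ LinearMap.proj c
  have hδ (x : ∀ c, R c) : δ x = ∑ c, (x c : B → ℚ) := by simp [δ]
  have hcomp : LinearMap.range (jacketDiff σ τ) ≤ LinearMap.ker δ := by
    rintro _ ⟨h, rfl⟩
    rw [LinearMap.mem_ker, hδ]
    ext b
    simp only [Finset.sum_apply, jacketDiff_apply, Finset.sum_sub_distrib, Pi.zero_apply]
    rw [Equiv.sum_comp τ fun c => h (σ c b), sub_self]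
  have hrange : Fintype.card B ≤ Module.finrank ℚ (LinearMap.range δ) + 1 := by
    refine card_le_finrank_add_one_of_transitive
      (S := Set.range fun c => facePerm σ c (τ c)) (fun b b' => ?_) _ ?_
    · obtain ⟨g, hg, hgb⟩ := hconn b b'
      exact ⟨g, colorGroup_le_closure_jacket σ hτ hg, hgb⟩
    · rintro _ ⟨c, rfl⟩ f
      refine ⟨Pi.single c ⟨_, f, rfl⟩, ?_⟩
      rw [hδ, Finset.sum_eq_single c (fun d _ hd => by simp [Pi.single_eq_of_ne hd]) (by simp)]
      simp
  have hker := finrank_ker_jacketDiff_le_one σ hconn hτ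
  have hβ := (jacketDiff σ τ).finrank_range_add_finrank_ker
  have hδ' := δ.finrank_range_add_finrank_ker
  have hmono := Submodule.finrank_mono hcomp
  rw [Module.finrank_fintype_fun_eq_card, ← Fintype.card_congr (σ 0)] at hβ
  rw [Module.finrank_pi_fintype] at hδ'
  have hsum : ∑ c, Module.finrank ℚ (R c) + jacketFaces σ τ ≤ (D + 1) * Fintype.card B := by
    rw [jacketFaces, ← Finset.sum_add_distrib]
    refine (Finset.sum_le_sum fun c _ =>
      finrank_range_permDiff_add_numCycles_le (facePerm σ c (τ c))).trans ?_
    simp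
  zify at hsum hβ hδ' hmono hker hrange
  linarith
end
end

section
/- Let D ≥ 2 and let G be a connected bipartite (D+1)-colored graph with p black vertices. Then the total number of faces of G satisfies F_G = (D(D−1)/2)·p + D − (2/(D−1)!)·Σ_J g_J, where the sum runs over all D!/2 jackets J of G and g_J = (2 − χ_J)/2 is the genus of J. Equivalently, in integer form: (D−1)!·F_G = (D−1)!·(D(D−1)/2)·p + D! − 2·Σ_J g_J. -/
noncomputable section
open scoped Classical in
/-- The finset of all cyclic permutations of `α`. -/
noncomputable def fullCycles (α : Type*) [Fintype α] [DecidableEq α] :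
    Finset (Equiv.Perm α) :=
  Finset.univ.filter IsFullCycle

/-- The full cycles of `α` are the permutations whose cycle type is `{card α}`. -/
theorem isFullCycle_iff_cycleType {α : Type*} [Fintype α] [DecidableEq α]
    (τ : Equiv.Perm α) :
    IsFullCycle τ ↔ τ.cycleType = {Fintype.card α} := by
  constructor
  · rintro ⟨hc, hs⟩
    rw [hc.cycleType, hs, Finset.card_univ]
  · intro h
    refine ⟨Equiv.Perm.card_cycleType_eq_one.1 (by simp [h]), ?_⟩
    rw [← Finset.card_eq_iff_eq_univ, ← Equiv.Perm.sum_cycleType, h, Multiset.sum_singleton]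

theorem card_fullCycles_fin (D : ℕ) (hD : 1 ≤ D) :
    (fullCycles (Fin (D + 1))).card = D.factorial := by
  have h := Equiv.Perm.card_of_cycleType_singleton (α := Fin (D + 1)) (n := D + 1)
    (by omega) (by simp)
  simp only [Fintype.card_fin, Nat.choose_self, mul_one, Nat.add_sub_cancel] at h
  rw [← h, fullCycles]
  congr 1
  ext τ
  simp [isFullCycle_iff_cycleType τ]

theorem IsFullCycle.conj {α : Type*} [Fintype α] [DecidableEq α] {τ : Equiv.Perm α}
    (hτ : IsFullCycle τ) (π : Equiv.Perm α) : IsFullCycle (π * τ * π⁻¹) := by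
  refine ⟨hτ.1.conj, ?_⟩
  rw [← Finset.card_eq_iff_eq_univ, Equiv.Perm.card_support_conj, hτ.2, Finset.card_univ]

theorem IsFullCycle.apply_ne {α : Type*} [Fintype α] [DecidableEq α] {τ : Equiv.Perm α}
    (hτ : IsFullCycle τ) (c : α) : τ c ≠ c := by
  rw [← Equiv.Perm.mem_support, hτ.2]
  exact Finset.mem_univ c

/-- Conjugation by a transposition shows that the number of full cycles sending `c` to `d ≠ c`
does not depend on `d`. -/
theorem card_fullCycles_apply_le {α : Type*} [Fintype α] [DecidableEq α] {c d e : α}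
    (hd : d ≠ c) (he : e ≠ c) :
    ((fullCycles α).filter (fun τ => τ c = d)).card ≤
      ((fullCycles α).filter (fun τ => τ c = e)).card := by
  refine Finset.card_le_card_of_injOn
    (fun τ => Equiv.swap d e * τ * (Equiv.swap d e)⁻¹) ?_ ?_
  · intro τ hτ
    simp only [fullCycles, Finset.coe_filter, Finset.mem_filter, Finset.mem_univ, true_and,
      Set.mem_ofPred_eq] at hτ ⊢
    refine ⟨hτ.1.conj _, ?_⟩
    simp [Equiv.Perm.mul_apply, Equiv.swap_inv, Equiv.swap_apply_of_ne_of_ne hd.symm he.symm, hτ.2]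
  · intro τ _ τ' _ h
    simpa using h

/-- The number of full cycles of `{0, …, D}` sending a color `c` to a color `d ≠ c`. -/
theorem card_fullCycles_fin_apply_eq (D : ℕ) (hD : 1 ≤ D) {c d : Fin (D + 1)} (hd : d ≠ c) :
    ((fullCycles (Fin (D + 1))).filter (fun τ => τ c = d)).card = (D - 1).factorial := by
  have hmaps : ∀ τ ∈ fullCycles (Fin (D + 1)), τ c ∈ Finset.univ.erase c := by
    intro τ hτ
    simp only [fullCycles, Finset.mem_filter, Finset.mem_univ, true_and] at hτ
    simpa using hτ.apply_ne c
  have h := Finset.card_eq_sum_card_fiberwise hmaps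
  rw [card_fullCycles_fin D hD, Finset.sum_congr rfl (fun e he =>
    (card_fullCycles_apply_le (Finset.ne_of_mem_erase he) hd).antisymm
      (card_fullCycles_apply_le hd (Finset.ne_of_mem_erase he)))] at h
  simp only [Finset.sum_const, Finset.card_erase_of_mem (Finset.mem_univ c), Finset.card_univ,
    Fintype.card_fin, Nat.add_sub_cancel, smul_eq_mul] at h
  rw [← Nat.mul_factorial_pred (by omega : D ≠ 0)] at h
  exact (Nat.eq_of_mul_eq_mul_left hD h).symm

theorem numCycles_inv {B : Type*} (π : Equiv.Perm B) : numCycles π⁻¹ = numCycles π := by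
  simp only [numCycles, numCyclesIn, cyclesIn, cycleSet, Equiv.Perm.sameCycle_inv]

theorem numCycles_facePerm_comm {D : ℕ} {B W : Type*} (σ : Fin (D + 1) → B ≃ W)
    (i j : Fin (D + 1)) : numCycles (facePerm σ i j) = numCycles (facePerm σ j i) :=
  numCycles_inv (facePerm σ j i)

theorem sum_offDiag_eq_two_mul_totalFaces {D : ℕ} {B W : Type*} (σ : Fin (D + 1) → B ≃ W) :
    ∑ c : Fin (D + 1), ∑ d ∈ Finset.univ.erase c, numCycles (facePerm σ c d) =
      2 * totalFaces σ := by
  have hsplit : ∀ c : Fin (D + 1), ∑ d ∈ Finset.univ.erase c, numCycles (facePerm σ c d) =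
      ∑ d, (if c < d then numCycles (facePerm σ c d) else 0) +
        ∑ d, (if d < c then numCycles (facePerm σ d c) else 0) := by
    intro c
    rw [← Finset.sum_add_distrib, ← Finset.filter_ne', Finset.sum_filter]
    refine Finset.sum_congr rfl fun d _ => ?_
    rcases lt_trichotomy c d with h | rfl | h
    · simp [h, h.ne', h.not_gt]
    · simp
    · simp [h, h.ne, h.not_gt, numCycles_facePerm_comm σ c d]
  have htotal : ∑ c : Fin (D + 1), ∑ d, (if c < d then numCycles (facePerm σ c d) else 0) =
      totalFaces σ := by
    rw [totalFaces, Finset.sum_filter, Fintype.sum_prod_type]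
  rw [Finset.sum_congr rfl (fun c _ => hsplit c), Finset.sum_add_distrib, htotal,
    Finset.sum_comm, htotal, two_mul]

/-- Each face belongs to `2 · (D - 1)!` oriented jackets. -/
theorem sum_jacketFaces {D : ℕ} (hD : 1 ≤ D) {B W : Type*} (σ : Fin (D + 1) → B ≃ W) :
    ∑ τ ∈ fullCycles (Fin (D + 1)), jacketFaces σ τ =
      2 * (D - 1).factorial * totalFaces σ := by
  have hcolor : ∀ c : Fin (D + 1),
      ∑ τ ∈ fullCycles (Fin (D + 1)), numCycles (facePerm σ c (τ c)) =
        ∑ d ∈ Finset.univ.erase c, (D - 1).factorial * numCycles (facePerm σ c d) := by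
    intro c
    have hmaps : ∀ τ ∈ fullCycles (Fin (D + 1)), τ c ∈ Finset.univ.erase c := by
      intro τ hτ
      simp only [fullCycles, Finset.mem_filter, Finset.mem_univ, true_and] at hτ
      simpa using hτ.apply_ne c
    rw [← Finset.sum_fiberwise_of_maps_to hmaps]
    refine Finset.sum_congr rfl fun d hd => ?_
    rw [Finset.sum_congr rfl (g := fun _ => numCycles (facePerm σ c d))
      (fun τ hτ => by rw [(Finset.mem_filter.1 hτ).2]), Finset.sum_const, smul_eq_mul,
      card_fullCycles_fin_apply_eq D hD (Finset.ne_of_mem_erase hd)]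
  simp only [jacketFaces]
  rw [Finset.sum_comm, Finset.sum_congr rfl (fun c _ => hcolor c)]
  simp only [← Finset.mul_sum]
  rw [sum_offDiag_eq_two_mul_totalFaces]
  ring

/-- For a connected bipartite `(D+1)`-colored graph with `p` black vertices,
`F_G = (D(D-1)/2)·p + D - (2/(D-1)!)·Σ_J g_J`, the sum running over the `D!/2`
jackets `J`, with `g_J = (2 - χ_J)/2` and `χ_J = 2p - (D+1)p + F_J`.
Integer form, summed over all cyclic permutations `τ` (each jacket `J = {τ, τ⁻¹}`
being counted twice, `Σ_τ (2 - χ_{J(τ)}) = 4·Σ_J g_J`):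
`2·(D-1)!·F_G = (D-1)!·D·(D-1)·p + 2·D! - Σ_τ (2 - χ_{J(τ)})`. -/
theorem face_count_in_terms_of_genera (D : ℕ) (hD : 2 ≤ D) (B W : Type)
    [Fintype B] [DecidableEq B] [Nonempty B] (σ : Fin (D + 1) → B ≃ W)
    (hconn : IsConnectedGraph σ) :
    2 * ((D - 1).factorial : ℤ) * (totalFaces σ : ℤ) =
      ((D - 1).factorial : ℤ) * ((D : ℤ) * ((D : ℤ) - 1)) * (Fintype.card B : ℤ) +
        2 * (D.factorial : ℤ) -
        ∑ τ ∈ fullCycles (Fin (D + 1)),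
          ((2 : ℤ) - (2 * (Fintype.card B : ℤ) - (D + 1) * (Fintype.card B : ℤ) +
            (jacketFaces σ τ : ℤ))) := by
  have hfaces : ∑ τ ∈ fullCycles (Fin (D + 1)), (jacketFaces σ τ : ℤ) =
      2 * ((D - 1).factorial : ℤ) * (totalFaces σ : ℤ) := by
    exact_mod_cast sum_jacketFaces (by omega) σ
  have hfact : (D.factorial : ℤ) = D * ((D - 1).factorial : ℤ) := by
    exact_mod_cast (Nat.mul_factorial_pred (by omega : D ≠ 0)).symm
  rw [Finset.sum_sub_distrib, Finset.sum_add_distrib, hfaces, Finset.sum_const, Finset.sum_const,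
    card_fullCycles_fin D (by omega), nsmul_eq_mul, nsmul_eq_mul, hfact]
  ring
end
end

section
/- Let D ≥ 3 and let G be a connected bipartite (D+1)-colored graph with p black vertices such that every jacket of G is planar (has genus 0) and such that for every color i there is exactly one D-bubble of colors î (i.e., the subgroup generated by {σ_k⁻¹ ∘ σ_j : j, k ≠ i} acts transitively on B). Then p = 1, i.e., G is the graph with a single black and a single white vertex joined by D+1 edges, one of each color. -/
noncomputable section
/-- The cycle of `π` through `b`, as an element of the set of all cycles of `π`. -/
def cycleMk {B : Type*} (π : Equiv.Perm B) (b : B) : cyclesIn π Set.univ :=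
  ⟨cycleSet π b, b, Set.mem_univ b, rfl⟩

theorem cycleMk_surjective {B : Type*} (π : Equiv.Perm B) :
    Function.Surjective (cycleMk π) := by
  rintro ⟨_, b, _, rfl⟩
  exact ⟨b, rfl⟩

theorem cycleMk_eq_iff {B : Type*} (π : Equiv.Perm B) (x y : B) :
    cycleMk π x = cycleMk π y ↔ π.SameCycle x y := by
  refine ⟨fun h => ?_, fun h => Subtype.ext (Set.ext fun z => ?_)⟩
  · have hset : cycleSet π x = cycleSet π y := congrArg Subtype.val h
    exact hset.ge (Equiv.Perm.SameCycle.refl π y)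
  · exact ⟨h.symm.trans, h.trans⟩

theorem cycleMk_apply {B : Type*} (π : Equiv.Perm B) (b : B) :
    cycleMk π (π b) = cycleMk π b := by
  rw [cycleMk_eq_iff, Equiv.Perm.sameCycle_apply_left]

theorem numCycles_eq_card {B : Type*} (π : Equiv.Perm B) :
    numCycles π = Nat.card (cyclesIn π Set.univ) := rfl

theorem numCycles_le_card {B : Type*} [Fintype B] (π : Equiv.Perm B) :
    numCycles π ≤ Fintype.card B := by
  rw [numCycles_eq_card, ← Nat.card_eq_fintype_card]
  exact Nat.card_le_card_of_surjective _ (cycleMk_surjective π)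

theorem numCycles_one {B : Type*} [Fintype B] :
    numCycles (1 : Equiv.Perm B) = Fintype.card B := by
  rw [numCycles_eq_card, ← Nat.card_eq_fintype_card]
  refine (Nat.card_congr (Equiv.ofBijective _ ⟨fun x y h => ?_, cycleMk_surjective 1⟩)).symm
  exact Equiv.Perm.sameCycle_one.1 ((cycleMk_eq_iff _ _ _).1 h)

theorem eq_one_of_numCycles_eq_card {B : Type*} [Fintype B] {π : Equiv.Perm B}
    (h : numCycles π = Fintype.card B) : π = 1 := by
  have := Finite.of_surjective _ (cycleMk_surjective π)
  have hbij : Function.Bijective (cycleMk π) :=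
    (Nat.bijective_iff_surjective_and_card _).2
      ⟨cycleMk_surjective π, by rw [Nat.card_eq_fintype_card, ← h, numCycles_eq_card]⟩
  ext b
  exact hbij.1 (cycleMk_apply π b)

/-- Nonnegativity of the genus (the Riemann–Hurwitz inequality): the faces of colors `{c, τ c}`,
for `c` in a finite set of colors permuted by `τ`, number at most `(n - 2) p + 2` as soon as
functions on black or white vertices invariant along these faces are constant. -/
theorem sum_numCycles_add_two_mul_card_le {ι B W : Type*} [Fintype ι] [Fintype B] [Fintype W]
    [Nonempty B] (σ : ι → B ≃ W) (τ : Equiv.Perm ι)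
    (hW : ∀ f : W → ℚ, (∀ c b, f (σ (τ c) b) = f (σ c b)) → ∀ w w', f w = f w')
    (hB : ∀ g : B → ℚ, (∀ c w, g ((σ (τ c)).symm w) = g ((σ c).symm w)) → ∀ b b', g b = g b')
    (hcard : Fintype.card W = Fintype.card B) :
    ∑ c, numCycles ((σ c).trans (σ (τ c)).symm) + 2 * Fintype.card B ≤
      Fintype.card ι * Fintype.card B + 2 := by
  classical
  obtain ⟨b₀⟩ := ‹Nonempty B›
  have : Nonempty W := Fintype.card_pos_iff.1 (hcard ▸ Fintype.card_pos_iff.2 ⟨b₀⟩)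
  obtain ⟨w₀⟩ := this
  let π : ι → Equiv.Perm B := fun c => (σ c).trans (σ (τ c)).symm
  have hfin : ∀ c, Finite (cyclesIn (π c) Set.univ) := fun c =>
    Finite.of_surjective _ (cycleMk_surjective (π c))
  have := fun c => Fintype.ofFinite (cyclesIn (π c) Set.univ)
  let δ : (ι → W → ℚ) →ₗ[ℚ] (B → ℚ) :=
    { toFun := fun F b => ∑ c, (F c (σ c b) - F c (σ (τ c) b))
      map_add' := fun F G => by
        ext b
        simp only [Pi.add_apply, ← Finset.sum_add_distrib]
        exact Finset.sum_congr rfl fun c _ => by ring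
      map_smul' := fun a F => by
        ext b
        simp only [Pi.smul_apply, smul_eq_mul, Finset.mul_sum, RingHom.id_apply]
        exact Finset.sum_congr rfl fun c _ => by ring }
  let θ : ((W → ℚ) × (∀ c, cyclesIn (π c) Set.univ → ℚ)) →ₗ[ℚ] (ι → W → ℚ) :=
    { toFun := fun x c w => x.1 w + x.2 c (cycleMk (π c) ((σ c).symm w))
      map_add' := fun x y => by
        ext c w
        simp only [Pi.add_apply, Prod.fst_add, Prod.snd_add]
        ring
      map_smul' := fun a x => by
        ext c w
        simp only [Pi.smul_apply, smul_eq_mul, Prod.smul_fst, Prod.smul_snd, RingHom.id_apply]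
        ring }
  have hθδ : ∀ x, δ (θ x) = 0 := by
    intro x
    ext b
    have hsum : ∑ c, x.1 (σ (τ c) b) = ∑ c, x.1 (σ c b) :=
      Equiv.sum_comp τ fun c => x.1 (σ c b)
    have hcyc : ∀ c, cycleMk (π c) ((σ c).symm (σ (τ c) b)) = cycleMk (π c) b := by
      intro c
      rw [← cycleMk_apply]
      simp [π]
    simp only [δ, θ, LinearMap.coe_mk, AddHom.coe_mk, Equiv.symm_apply_apply, hcyc,
      Finset.sum_sub_distrib, Finset.sum_add_distrib, hsum, sub_self, Pi.zero_apply]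
  let θ' : ((W → ℚ) × (∀ c, cyclesIn (π c) Set.univ → ℚ)) →ₗ[ℚ] LinearMap.ker δ × ℚ :=
    (θ.codRestrict (LinearMap.ker δ) hθδ).prod
      ((LinearMap.proj w₀).comp (LinearMap.fst ℚ (W → ℚ) _))
  have hθ' : Function.Injective θ' := by
    rw [← LinearMap.ker_eq_bot, LinearMap.ker_eq_bot']
    intro x hx
    have hx1 : ∀ c w, x.1 w + x.2 c (cycleMk (π c) ((σ c).symm w)) = 0 := fun c w =>
      congrFun (congrFun (congrArg Subtype.val (congrArg Prod.fst hx)) c) w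
    have hx2 : x.1 w₀ = 0 := congrArg Prod.snd hx
    have hf : ∀ w, x.1 w = 0 := by
      intro w
      rw [← hx2]
      refine hW _ (fun c b => ?_) _ _
      have h1 := hx1 c (σ (τ c) b)
      have h2 := hx1 c (σ c b)
      rw [← cycleMk_apply] at h1
      simp only [π, Equiv.trans_apply, Equiv.apply_symm_apply, Equiv.symm_apply_apply] at h1 h2
      linarith
    refine Prod.ext (funext hf) (funext fun c => funext fun q => ?_)
    obtain ⟨b, rfl⟩ := cycleMk_surjective _ q
    have := hx1 c (σ c b)
    rw [hf, zero_add, Equiv.symm_apply_apply] at this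
    exact this
  have hker : Fintype.card B + ∑ c, numCycles (π c) ≤ Module.finrank ℚ (LinearMap.ker δ) + 1 := by
    have := LinearMap.finrank_le_finrank_of_injective hθ'
    simpa [Module.finrank_prod, Module.finrank_pi_fintype, hcard, numCycles_eq_card,
      Nat.card_eq_fintype_card] using this
  let ev : LinearMap.ker δ.dualMap →ₗ[ℚ] ℚ :=
    { toFun := fun l => l.1 (Pi.single b₀ 1)
      map_add' := fun _ _ => rfl
      map_smul' := fun _ _ => rfl }
  have hev : Function.Injective ev := by
    rw [← LinearMap.ker_eq_bot, LinearMap.ker_eq_bot']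
    rintro ⟨l, hl⟩ hlb
    have hl' : ∀ F, l (δ F) = 0 := fun F => LinearMap.congr_fun hl F
    have hδ : ∀ c w, δ (Pi.single c (Pi.single w 1)) =
        Pi.single ((σ c).symm w) 1 - Pi.single ((σ (τ c)).symm w) 1 := by
      intro c w
      ext b
      simp only [δ, LinearMap.coe_mk, AddHom.coe_mk]
      rw [Finset.sum_eq_single c (fun d _ hd => by simp [Pi.single_eq_of_ne hd]) (by simp)]
      simp [Pi.single_apply, Equiv.eq_symm_apply]
    have hconst := hB (fun b => l (Pi.single b 1)) fun c w => by
      have := hl' (Pi.single c (Pi.single w 1))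
      rw [hδ, map_sub] at this
      exact (sub_eq_zero.1 this).symm
    refine Subtype.ext (LinearMap.pi_ext' fun b => LinearMap.ext_ring ?_)
    exact (hconst b b₀).trans hlb
  have hcoker : Module.finrank ℚ (LinearMap.ker δ.dualMap) ≤ 1 := by
    simpa using LinearMap.finrank_le_finrank_of_injective hev
  have h1 := δ.dualMap.finrank_range_add_finrank_ker
  have h2 := δ.finrank_range_add_finrank_ker
  rw [LinearMap.finrank_range_dualMap_eq_finrank_range, Subspace.dual_finrank_eq] at h1
  simp only [Module.finrank_pi_fintype, Module.finrank_self, Finset.sum_const, Finset.card_univ,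
    smul_eq_mul, mul_one, hcard] at h1 h2
  change ∑ c, numCycles (π c) + _ ≤ _
  omega

theorem exists_isFullCycle_apply {n : ℕ} (hn : 3 ≤ n) {a b c : Fin n}
    (hab : a ≠ b) (hbc : b ≠ c) (hac : a ≠ c) :
    ∃ τ : Equiv.Perm (Fin n), IsFullCycle τ ∧ τ a = b ∧ τ b = c := by
  obtain ⟨m, rfl⟩ : ∃ m, n = m + 3 := ⟨n - 3, by omega⟩
  obtain ⟨e, he⟩ : ∃ e : Equiv.Perm (Fin (m + 3)), e 0 = a ∧ e 1 = b ∧ e 2 = c := by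
    have := Equiv.Perm.isMultiplyPretransitive (Fin (m + 3)) 3
    have h01 : (0 : Fin (m + 3)) ≠ 1 := by simp
    have h02 : (0 : Fin (m + 3)) ≠ 2 := by simp [Fin.ext_iff, Nat.mod_eq_of_lt]
    have h12 : (1 : Fin (m + 3)) ≠ 2 := by simp [Fin.ext_iff, Nat.mod_eq_of_lt]
    obtain ⟨e, he⟩ := MulAction.exists_smul_eq (Equiv.Perm (Fin (m + 3)))
      (⟨![0, 1, 2], by intro i j; fin_cases i <;> fin_cases j <;> simp [*, Ne.symm]⟩ :
        Fin 3 ↪ Fin (m + 3))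
      ⟨![a, b, c], by intro i j; fin_cases i <;> fin_cases j <;> simp [*, Ne.symm]⟩
    exact ⟨e, DFunLike.congr_fun he 0, DFunLike.congr_fun he 1, DFunLike.congr_fun he 2⟩
  obtain ⟨rfl, rfl, rfl⟩ := he
  refine ⟨e * finRotate (m + 3) * e⁻¹, ⟨isCycle_finRotate.conj, ?_⟩, ?_, ?_⟩
  · rw [Equiv.Perm.support_conj, support_finRotate, Finset.map_univ_equiv]
  · simp
  · simp
    rfl

theorem IsFullCycle.apply_eq_of_invariant {α β : Type*} [Fintype α] [DecidableEq α]
    {τ : Equiv.Perm α} (hτ : IsFullCycle τ) {φ : α → β} (hφ : ∀ x, φ (τ x) = φ x) (x y : α) :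
    φ x = φ y := by
  have hmem : ∀ z, τ z ≠ z := fun z => by
    rw [← Equiv.Perm.mem_support, hτ.2]
    exact Finset.mem_univ z
  obtain ⟨n, rfl⟩ := (hτ.1.sameCycle (hmem x) (hmem y)).exists_nat_pow_eq
  induction n with
  | zero => rfl
  | succ n ih => rw [pow_succ', Equiv.Perm.mul_apply, hφ, ← ih]

/-- Removing the point `b` from a full cycle leaves a full cycle on the other points. -/
theorem IsFullCycle.apply_eq_of_invariant_swap_mul {α β : Type*} [Fintype α] [DecidableEq α]
    {τ : Equiv.Perm α} (hτ : IsFullCycle τ) {a b c : α} (hab : a ≠ b) (hbc : b ≠ c)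
    (ha : τ a = b) (hb : τ b = c) {φ : α → β} (hφ : ∀ x, φ ((Equiv.swap b c * τ) x) = φ x)
    {x y : α} (hx : x ≠ b) (hy : y ≠ b) : φ x = φ y := by
  have key := hτ.apply_eq_of_invariant (φ := Function.update φ b (φ a)) (fun z => by
    have hz := hφ z
    rw [Equiv.Perm.mul_apply] at hz
    rcases eq_or_ne z b with rfl | hzb
    · have := hφ a
      rw [Equiv.Perm.mul_apply, ha, Equiv.swap_apply_left] at this
      simp [hb, hbc.symm, this]
    rcases eq_or_ne z a with rfl | hza
    · simp [ha, hab]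
    have h1 : τ z ≠ b := fun h => hza (τ.injective (h.trans ha.symm))
    have h2 : τ z ≠ c := fun h => hzb (τ.injective (h.trans hb.symm))
    rw [Equiv.swap_apply_of_ne_of_ne h1 h2] at hz
    simp [h1, hzb, hz]) x y
  simpa [hx, hy] using key

theorem apply_eq_of_mem_closure {B β : Type*} {S : Set (Equiv.Perm B)} {φ : B → β}
    (hφ : ∀ π ∈ S, ∀ b, φ (π b) = φ b) {g : Equiv.Perm B} (hg : g ∈ Subgroup.closure S) :
    ∀ b, φ (g b) = φ b := by
  induction hg using Subgroup.closure_induction with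
  | mem π h => exact hφ π h
  | one => exact fun b => rfl
  | mul x y _ _ hx hy => exact fun b => (hx _).trans (hy b)
  | inv x _ hx => exact fun b => by simpa using (hx (x⁻¹ b)).symm

theorem numCycles_add_card_le {D : ℕ} (hD : 2 ≤ D)
    {B W : Type*} [Fintype B] [Nonempty B] (σ : Fin (D + 1) → B ≃ W)
    (hplanar : ∀ τ : Equiv.Perm (Fin (D + 1)), IsFullCycle τ →
      2 * (Fintype.card B : ℤ) - (D + 1) * (Fintype.card B : ℤ) +
        (jacketFaces σ τ : ℤ) = 2)
    (hbubble : ∀ i : Fin (D + 1), ∀ b b' : B, ∃ g ∈ bubbleGroup σ i, g b = b')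
    {a b c : Fin (D + 1)} (hab : a ≠ b) (hbc : b ≠ c) (hac : a ≠ c) :
    numCycles (facePerm σ a c) + Fintype.card B ≤
      numCycles (facePerm σ a b) + numCycles (facePerm σ b c) := by
  have : Fintype W := Fintype.ofEquiv B (σ 0)
  obtain ⟨τ, hτ, ha, hb⟩ := exists_isFullCycle_apply (by omega) hab hbc hac
  have hinv : ∀ φ : B → ℚ, (∀ j k, j ≠ b → k ≠ b → ∀ x, φ (facePerm σ j k x) = φ x) →
      ∀ x y, φ x = φ y := by
    intro φ hφ x y
    obtain ⟨g, hg, rfl⟩ := hbubble b x y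
    refine (apply_eq_of_mem_closure ?_ hg x).symm
    rintro _ ⟨j, k, hj, hk, rfl⟩
    exact hφ j k hj hk
  have hle := sum_numCycles_add_two_mul_card_le σ (Equiv.swap b c * τ)
    (fun f hf w w' => by
      have hcol : ∀ j k, j ≠ b → k ≠ b → (fun x => f (σ j x)) = fun x => f (σ k x) :=
        fun j k hj hk => hτ.apply_eq_of_invariant_swap_mul hab hbc ha hb
          (φ := fun j x => f (σ j x)) (fun j => funext (hf j)) hj hk
      have := hinv (fun x => f (σ a x)) (fun j k hj hk x => by
        rw [congrFun (hcol a k hab hk), congrFun (hcol a j hab hj)]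
        simp [facePerm]) ((σ a).symm w) ((σ a).symm w')
      simpa using this)
    (fun g hg => hinv g fun j k hj hk x => by
      have hcol : (fun w => g ((σ k).symm w)) = fun w => g ((σ j).symm w) :=
        hτ.apply_eq_of_invariant_swap_mul hab hbc ha hb
          (φ := fun j w => g ((σ j).symm w)) (fun j => funext (hg j)) hk hj
      simpa [facePerm] using congrFun hcol (σ j x))
    (Fintype.card_congr (σ 0).symm)
  have hsum : jacketFaces σ (Equiv.swap b c * τ) + numCycles (facePerm σ a b) +
      numCycles (facePerm σ b c) =
      jacketFaces σ τ + numCycles (facePerm σ a c) + Fintype.card B := by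
    have hsplit : ∀ υ : Equiv.Perm (Fin (D + 1)), jacketFaces σ υ =
        numCycles (facePerm σ a (υ a)) + (numCycles (facePerm σ b (υ b)) +
          ∑ x ∈ (Finset.univ.erase a).erase b, numCycles (facePerm σ x (υ x))) := by
      intro υ
      rw [Finset.add_sum_erase _ (fun x => numCycles (facePerm σ x (υ x)))
          (by simp [hab.symm] : b ∈ Finset.univ.erase a),
        Finset.add_sum_erase _ (fun x => numCycles (facePerm σ x (υ x))) (Finset.mem_univ a)]
      rfl
    have hrest : ∑ x ∈ (Finset.univ.erase a).erase b,
          numCycles (facePerm σ x ((Equiv.swap b c * τ) x)) =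
        ∑ x ∈ (Finset.univ.erase a).erase b, numCycles (facePerm σ x (τ x)) := by
      refine Finset.sum_congr rfl fun x hx => ?_
      simp only [Finset.mem_erase, Finset.mem_univ, and_true] at hx
      rw [Equiv.Perm.mul_apply, Equiv.swap_apply_of_ne_of_ne
        (fun h => hx.2 (τ.injective (h.trans ha.symm)))
        (fun h => hx.1 (τ.injective (h.trans hb.symm)))]
    have hself : numCycles (facePerm σ b b) = Fintype.card B := by
      rw [← numCycles_one]
      congr 1
      exact (σ b).self_trans_symm
    rw [hsplit, hsplit τ, hrest]
    simp only [Equiv.Perm.mul_apply, ha, hb, Equiv.swap_apply_left, Equiv.swap_apply_right, hself]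
    omega
  have hpl := hplanar τ hτ
  change jacketFaces σ (Equiv.swap b c * τ) + _ ≤ _ at hle
  rw [Fintype.card_fin] at hle
  zify at hle hsum ⊢
  linarith

/-- Let `D ≥ 3` and let `G` be a connected bipartite `(D+1)`-colored graph all of whose
jackets are planar (`χ_J = 2`) and which has, for every color `i`, exactly one
`D`-bubble of colors `î` (the group generated by the `σ_k⁻¹ ∘ σ_j`, `j, k ≠ i`, acts
transitively on `B`).  Then `p = 1`: `G` is the graph with a single black and a single
white vertex joined by `D+1` edges. -/
theorem all_jackets_planar_one_bubble_implies_two_vertices (D : ℕ) (hD : 3 ≤ D)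
    (B W : Type) [Fintype B] [DecidableEq B] [Nonempty B] (σ : Fin (D + 1) → B ≃ W)
    (hconn : IsConnectedGraph σ)
    (hplanar : ∀ τ : Equiv.Perm (Fin (D + 1)), IsFullCycle τ →
      2 * (Fintype.card B : ℤ) - (D + 1) * (Fintype.card B : ℤ) +
        (jacketFaces σ τ : ℤ) = 2)
    (hbubble : ∀ i : Fin (D + 1), ∀ b b' : B, ∃ g ∈ bubbleGroup σ i, g b = b') :
    Fintype.card B = 1 := by
  have hface : ∀ i j, facePerm σ i j = 1 := by
    intro a b
    rcases eq_or_ne a b with rfl | hab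
    · exact (σ a).self_trans_symm
    obtain ⟨c, hc⟩ : ∃ c, c ∉ ({a, b} : Finset (Fin (D + 1))) :=
      Finset.exists_mem_notMem_of_card_lt_card
        (s := {a, b}) (t := Finset.univ)
        (Finset.card_le_two.trans_lt (by rw [Finset.card_fin]; omega)) |>.imp fun _ h => h.2
    simp only [Finset.mem_insert, Finset.mem_singleton, not_or] at hc
    obtain ⟨hca : c ≠ a, hcb : c ≠ b⟩ := hc
    refine eq_one_of_numCycles_eq_card (le_antisymm (numCycles_le_card _) ?_)
    have key := fun {a b c : Fin (D + 1)} => numCycles_add_card_le (a := a) (b := b) (c := c)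
      (by omega) σ hplanar hbubble
    have h1 := key hab hcb.symm hca.symm
    have h2 := key hcb.symm hca hab.symm
    have h3 := key hca hab hcb
    have h4 := key hcb hab.symm hca
    have h5 := key hab.symm hca.symm hcb.symm
    have h6 := key hca.symm hcb hab
    have hle := fun i j => numCycles_le_card (facePerm σ i j)
    linarith [hle a b, hle b a, hle b c, hle c b, hle a c, hle c a]
  rw [Fintype.card_eq_one_iff]
  obtain ⟨b₀⟩ := ‹Nonempty B›
  refine ⟨b₀, fun b => ?_⟩
  obtain ⟨g, hg, rfl⟩ := hconn b₀ b
  refine apply_eq_of_mem_closure (φ := id) ?_ hg b₀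
  rintro _ ⟨i, j, rfl⟩ x
  rw [hface]
  rfl
end
end

section
/- Let Δ be a finite nonempty set of even cardinality 2m, let σ be a permutation of Δ, let α be a fixed-point-free involution of Δ, and suppose the subgroup generated by σ and α acts transitively on Δ. Denote by c(π) the number of cycles (orbits, including fixed points) of a permutation π of Δ. Then c(σ) + c(σ∘α) ≤ m + 2, and c(σ) + c(σ∘α) ≡ m (mod 2). (Equivalently: the Euler characteristic χ := c(σ) − m + c(σ∘α) of the connected ribbon graph with rotation system σ and edge involution α is an even integer with χ ≤ 2.) -/
noncomputable section

open Equiv Equiv.Perm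

/-- The setoid obtained from `r` by identifying the classes of `a` and `b`. -/
def Setoid.merge {B : Type*} (r : Setoid B) (a b : B) : Setoid B where
  r x y := r x y ∨ ((r x a ∨ r x b) ∧ (r y a ∨ r y b))
  iseqv := by
    refine ⟨fun x => Or.inl (r.refl x), ?_, ?_⟩
    · rintro x y (h | ⟨h, h'⟩)
      · exact Or.inl (r.symm h)
      · exact Or.inr ⟨h', h⟩
    · rintro x y z (h | ⟨h, h'⟩) (k | ⟨k, k'⟩)
      · exact Or.inl (r.trans h k)
      · exact Or.inr ⟨k.imp (r.trans h) (r.trans h), k'⟩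
      · exact Or.inr ⟨h, h'.imp (r.trans (r.symm k)) (r.trans (r.symm k))⟩
      · exact Or.inr ⟨h, k'⟩

theorem Setoid.le_merge {B : Type*} (r : Setoid B) (a b : B) : r ≤ r.merge a b :=
  fun _ _ h => Or.inl h

theorem Setoid.merge_rel {B : Type*} (r : Setoid B) (a b : B) : r.merge a b a b :=
  Or.inr ⟨Or.inl (r.refl a), Or.inr (r.refl b)⟩

theorem Setoid.merge_le {B : Type*} {r s : Setoid B} {a b : B} (h : r ≤ s) (hab : s a b) :
    r.merge a b ≤ s := by
  have key : ∀ {x}, r x a ∨ r x b → s x a := fun hx =>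
    hx.elim (fun hx => h hx) (fun hx => s.trans (h hx) (s.symm hab))
  rintro x y (hxy | ⟨hx, hy⟩)
  · exact h hxy
  · exact s.trans (key hx) (s.symm (key hy))

theorem Setoid.merge_eq_self {B : Type*} {r : Setoid B} {a b : B} (hab : r a b) :
    r.merge a b = r :=
  le_antisymm (Setoid.merge_le le_rfl hab) (r.le_merge a b)

theorem Setoid.card_quotient_merge {B : Type*} [Finite B] {r : Setoid B} {a b : B}
    (hab : ¬ r a b) :
    Nat.card (Quotient (r.merge a b)) + 1 = Nat.card (Quotient r) := by
  classical
  let f : {q : Quotient r // q ≠ ⟦b⟧} → Quotient (r.merge a b) :=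
    fun q => Setoid.map_of_le (r.le_merge a b) q.1
  have hf : Function.Bijective f := by
    constructor
    · rintro ⟨p, hp⟩ ⟨q, hq⟩
      induction p using Quotient.inductionOn with | _ x
      induction q using Quotient.inductionOn with | _ y
      intro h
      have hx : ¬ r x b := fun h => hp (Quotient.sound h)
      have hy : ¬ r y b := fun h => hq (Quotient.sound h)
      refine Subtype.ext (Quotient.sound ?_)
      rcases (Quotient.exact h : r.merge a b x y) with h | ⟨h, h'⟩
      · exact h
      · exact r.trans (h.resolve_right hx) (r.symm (h'.resolve_right hy))
    · intro q
      induction q using Quotient.inductionOn with | _ x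
      by_cases hx : r x b
      · refine ⟨⟨⟦a⟧, fun h => hab (Quotient.exact h)⟩, Quotient.sound ?_⟩
        exact Or.inr ⟨Or.inl (r.refl a), Or.inr hx⟩
      · exact ⟨⟨⟦x⟧, fun h => hx (Quotient.exact h)⟩, rfl⟩
  have := Fintype.ofFinite (Quotient r)
  rw [← Nat.card_congr (Equiv.ofBijective f hf), Nat.card_eq_fintype_card,
    Nat.card_eq_fintype_card, Fintype.card_subtype_compl, Fintype.card_subtype_eq]
  exact Nat.sub_add_cancel (Fintype.card_pos_iff.2 ⟨⟦b⟧⟩)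

theorem Setoid.card_quotient_le_card_merge {B : Type*} [Finite B] (r : Setoid B) (a b : B) :
    Nat.card (Quotient r) ≤ Nat.card (Quotient (r.merge a b)) + 1 := by
  by_cases hab : r a b
  · rw [Setoid.merge_eq_self hab]; omega
  · exact (Setoid.card_quotient_merge hab).ge

theorem Setoid.card_quotient_anti {B : Type*} [Finite B] {r s : Setoid B} (h : r ≤ s) :
    Nat.card (Quotient s) ≤ Nat.card (Quotient r) :=
  Nat.card_le_card_of_surjective (Setoid.map_of_le h) fun q =>
    Quotient.inductionOn q fun x => ⟨⟦x⟧, rfl⟩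

theorem numCycles_eq_card_quotient {B : Type*} (π : Perm B) :
    numCycles π = Nat.card (Quotient (SameCycle.setoid π)) := by
  have hker : SameCycle.setoid π = Setoid.ker (cycleSet π) := by
    ext x y
    refine ⟨fun h => Set.ext fun z => ⟨fun k => h.symm.trans k, fun k => h.trans k⟩, fun h => ?_⟩
    have hy : y ∈ cycleSet π y := SameCycle.refl π y
    rw [← (h : cycleSet π x = cycleSet π y)] at hy
    exact hy
  have hrange : cyclesIn π Set.univ = Set.range (cycleSet π) := by
    ext t
    simp [cyclesIn, eq_comm]
  rw [numCycles, numCyclesIn, hrange, hker]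
  exact (Nat.card_congr (Setoid.quotientKerEquivRange (cycleSet π))).symm

theorem sameCycle_setoid_le {B : Type*} [Finite B] {π : Perm B} {r : Setoid B}
    (h : ∀ x, r x (π x)) : SameCycle.setoid π ≤ r := by
  intro x y hxy
  obtain ⟨n, rfl⟩ := SameCycle.exists_nat_pow_eq hxy
  clear hxy
  induction n with
  | zero => exact r.refl x
  | succ n ih =>
    rw [pow_succ', Perm.mul_apply]
    exact r.trans ih (h _)

theorem sameCycle_setoid_mul_swap_le {B : Type*} [Finite B] [DecidableEq B] (π : Perm B)
    (a b : B) :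
    SameCycle.setoid (π * swap a b) ≤ (SameCycle.setoid π).merge a b := by
  refine sameCycle_setoid_le fun x => ?_
  have hπ : ∀ y, (SameCycle.setoid π).merge a b y (π y) :=
    fun y => Or.inl (sameCycle_apply_right.2 (SameCycle.refl π y))
  have hab := (SameCycle.setoid π).merge_rel a b
  rw [Perm.mul_apply]
  refine Setoid.trans' _ ?_ (hπ _)
  rw [swap_apply_def]
  split_ifs with ha hb
  · exact ha ▸ hab
  · rw [hb]
    exact Setoid.symm' _ hab
  · exact Setoid.refl' _ x

theorem numCycles_eq_card_cycleType {B : Type*} [Fintype B] [DecidableEq B] (π : Perm B) :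
    numCycles π + π.cycleType.sum = Fintype.card B + Multiset.card π.cycleType := by
  have hne : ∀ c : π.cycleFactorsFinset, ∃ x, x ∈ c.1.support := fun c =>
    (mem_cycleFactorsFinset_iff.1 c.2).1.nonempty_support
  choose p hp using hne
  let f : π.cycleFactorsFinset ⊕ Function.fixedPoints π → Quotient (SameCycle.setoid π) :=
    Sum.elim (fun c => ⟦p c⟧) (fun x => ⟦x.1⟧)
  have hmov : ∀ c, π (p c) ≠ p c := fun c =>
    mem_support.1 (mem_cycleFactorsFinset_support_le c.2 (hp c))
  have hf : Function.Bijective f := by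
    constructor
    · rintro (c | x) (d | y) h
      · have h' : π.SameCycle (p c) (p d) := Quotient.exact h
        refine congrArg Sum.inl (Subtype.ext ?_)
        rw [cycle_is_cycleOf (hp c) c.2, cycle_is_cycleOf (hp d) d.2, h'.cycleOf_eq]
      · have h' : π.SameCycle (p c) y := Quotient.exact h
        exact absurd (h'.apply_eq_self_iff.2 y.2) (hmov c)
      · have h' : π.SameCycle x (p d) := Quotient.exact h
        exact absurd (h'.apply_eq_self_iff.1 x.2) (hmov d)
      · have h' : π.SameCycle x y := Quotient.exact h
        exact congrArg Sum.inr (Subtype.ext (h'.eq_of_left x.2))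
    · intro q
      induction q using Quotient.inductionOn with | _ x
      by_cases hx : π x = x
      · exact ⟨Sum.inr ⟨x, hx⟩, rfl⟩
      · let c : π.cycleFactorsFinset :=
          ⟨π.cycleOf x, cycleOf_mem_cycleFactorsFinset_iff.2 (mem_support.2 hx)⟩
        exact ⟨Sum.inl c, Quotient.sound (mem_support_cycleOf_iff.1 (hp c)).1.symm⟩
  have hcard := Nat.card_congr (Equiv.ofBijective f hf)
  rw [Nat.card_eq_fintype_card, Fintype.card_sum, card_fixedPoints, Fintype.card_coe] at hcard
  have := π.sum_cycleType_le
  have hct : Multiset.card π.cycleType = π.cycleFactorsFinset.card := by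
    rw [cycleType_def, Multiset.card_map]; rfl
  rw [numCycles_eq_card_quotient]
  omega

theorem sign_eq_neg_one_pow_numCycles {B : Type*} [Fintype B] [DecidableEq B] (π : Perm B) :
    sign π = (-1) ^ (Fintype.card B + numCycles π) := by
  have := numCycles_eq_card_cycleType π
  rw [sign_of_cycleType, Units.ext_iff]
  push_cast
  rw [neg_one_pow_congr]
  simp only [Nat.even_iff]
  omega

theorem numCycles_mul_swap_le {B : Type*} [Finite B] [DecidableEq B] (π : Perm B) (a b : B) :
    numCycles (π * swap a b) ≤ numCycles π + 1 := by
  have h := sameCycle_setoid_mul_swap_le (π * swap a b) a b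
  rw [mul_assoc, swap_mul_self, mul_one] at h
  simp only [numCycles_eq_card_quotient]
  exact ((SameCycle.setoid (π * swap a b)).card_quotient_le_card_merge a b).trans
    (Nat.succ_le_succ (Setoid.card_quotient_anti h))

theorem numCycles_mul_swap_of_not_sameCycle {B : Type*} [Fintype B] [DecidableEq B]
    {π : Perm B} {a b : B} (hab : ¬ π.SameCycle a b) :
    numCycles (π * swap a b) + 1 = numCycles π := by
  have hne : a ≠ b := fun h => hab (h ▸ SameCycle.refl π a)
  have h₁ := sameCycle_setoid_mul_swap_le π a b
  have h₂ := sameCycle_setoid_mul_swap_le (π * swap a b) a b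
  rw [mul_assoc, swap_mul_self, mul_one] at h₂
  have heq : (SameCycle.setoid (π * swap a b)).merge a b = (SameCycle.setoid π).merge a b :=
    le_antisymm (Setoid.merge_le h₁ (Setoid.merge_rel _ a b))
      (Setoid.merge_le h₂ (Setoid.merge_rel _ a b))
  have hπ := Setoid.card_quotient_merge (r := SameCycle.setoid π) hab
  rw [← numCycles_eq_card_quotient] at hπ
  by_cases h : (π * swap a b).SameCycle a b
  · rw [numCycles_eq_card_quotient (π * swap a b),
      ← Setoid.merge_eq_self (r := SameCycle.setoid (π * swap a b)) h, heq, hπ]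
  · have hπs := Setoid.card_quotient_merge (r := SameCycle.setoid (π * swap a b)) h
    rw [heq, hπ, ← numCycles_eq_card_quotient] at hπs
    have hs := sign_mul π (swap a b)
    rw [sign_swap hne, sign_eq_neg_one_pow_numCycles, sign_eq_neg_one_pow_numCycles π, hπs,
      mul_neg_one] at hs
    exact absurd hs (units_ne_neg_self _)

theorem exists_setoid_numCycles_le {B : Type*} [Fintype B] [DecidableEq B] (σ τ : Perm B) :
    ∃ r : Setoid B, SameCycle.setoid σ ≤ r ∧ SameCycle.setoid (σ * τ) ≤ r ∧
      numCycles σ + numCycles τ + numCycles (σ * τ) ≤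
        Fintype.card B + 2 * Nat.card (Quotient r) := by
  induction hk : Fintype.card B - numCycles τ using Nat.strong_induction_on generalizing τ with
  | _ k ih
  have hle : ∀ π : Perm B, numCycles π ≤ Fintype.card B := fun π => by
    rw [numCycles_eq_card_quotient, ← Nat.card_eq_fintype_card]
    exact Nat.card_le_card_of_surjective _ Quotient.mk_surjective
  by_cases hτ : ∀ x, τ x = x
  · obtain rfl : τ = 1 := Perm.ext hτ
    refine ⟨SameCycle.setoid σ, le_rfl, by rw [mul_one], ?_⟩
    have := hle 1
    rw [mul_one, ← numCycles_eq_card_quotient]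
    omega
  push Not at hτ
  obtain ⟨b, hb⟩ := hτ
  obtain ⟨a, rfl⟩ : ∃ a, τ b = a := ⟨_, rfl⟩
  set τ' := τ * swap (τ b) b with hτ'
  have hfix : τ' (τ b) = τ b := by simp [hτ']
  have hns : ¬ τ'.SameCycle (τ b) b := fun h => hb (h.eq_of_left hfix)
  have hτs : τ' * swap (τ b) b = τ := by rw [hτ', mul_assoc, swap_mul_self, mul_one]
  have hc := numCycles_mul_swap_of_not_sameCycle hns
  rw [hτs] at hc
  have := hle τ'
  obtain ⟨r, hσ, hστ, hr⟩ := ih _ (by omega) τ' rfl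
  have hmul : σ * τ = σ * τ' * swap (τ b) b := by rw [mul_assoc, hτs]
  refine ⟨r.merge (τ b) b, hσ.trans (r.le_merge _ _), ?_, ?_⟩
  · rw [hmul]
    exact (sameCycle_setoid_mul_swap_le _ _ _).trans
      (Setoid.merge_le (hστ.trans (r.le_merge _ _)) (r.merge_rel _ _))
  · rw [hmul]
    by_cases hrab : r (τ b) b
    · have := numCycles_mul_swap_le (σ * τ') (τ b) b
      rw [Setoid.merge_eq_self hrab]
      omega
    · have := Setoid.card_quotient_merge hrab
      have := numCycles_mul_swap_of_not_sameCycle (π := σ * τ') fun h => hrab (hστ h)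
      omega

theorem two_mul_numCycles_of_involutive {B : Type*} [Fintype B] [DecidableEq B] {α : Perm B}
    (hinv : ∀ d, α (α d) = d) (hfree : ∀ d, α d ≠ d) :
    2 * numCycles α = Fintype.card B := by
  have hsq : α ^ 2 = 1 := Perm.ext fun d => by rw [sq, Perm.mul_apply, hinv, Perm.one_apply]
  have hsupp : α.support = Finset.univ := Finset.eq_univ_iff_forall.2 fun d =>
    mem_support.2 (hfree d)
  have hsum := α.sum_cycleType
  have hct := cycleType_of_pow_prime_eq_one hsq
  have hcount := numCycles_eq_card_cycleType α
  rw [hsupp, Finset.card_univ] at hsum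
  have hsum' : α.cycleType.sum = Multiset.card α.cycleType * 2 := by
    conv_lhs => rw [hct]
    simp
  omega

/-- A connected ribbon graph on a nonempty dart set `Δ` of cardinality `2m`, given by
a rotation system `σ` and a fixed-point-free edge involution `α`, satisfies
`c(σ) + c(σ∘α) ≤ m + 2` and `c(σ) + c(σ∘α) ≡ m (mod 2)`: its Euler characteristic
`χ = c(σ) - m + c(σ∘α)` is an even integer with `χ ≤ 2`. -/
theorem ribbon_graph_euler_characteristic (Δ : Type) [Fintype Δ] [DecidableEq Δ]
    [Nonempty Δ] (m : ℕ) (hcard : Fintype.card Δ = 2 * m)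
    (σ α : Equiv.Perm Δ)
    (hinv : ∀ d, α (α d) = d) (hfree : ∀ d, α d ≠ d)
    (htrans : ∀ d d' : Δ,
      ∃ g ∈ Subgroup.closure ({σ, α} : Set (Equiv.Perm Δ)), g d = d') :
    numCycles σ + numCycles (σ * α) ≤ m + 2 ∧
    numCycles σ + numCycles (σ * α) ≡ m [MOD 2] := by
  have hα := two_mul_numCycles_of_involutive hinv hfree
  constructor
  · obtain ⟨r, hσ, hστ, hr⟩ := exists_setoid_numCycles_le σ α
    have hrσ : ∀ x, r x (σ x) := fun x => hσ (sameCycle_apply_right.2 (SameCycle.refl σ x))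
    have hrα : ∀ x, r x (α x) := fun x =>
      r.trans (hστ (sameCycle_apply_right.2 (SameCycle.refl (σ * α) x))) (r.symm (hrσ (α x)))
    have hrg : ∀ g ∈ Subgroup.closure ({σ, α} : Set (Equiv.Perm Δ)), ∀ x, r x (g x) := by
      intro g hg
      induction hg using Subgroup.closure_induction with
      | mem g hg =>
        rcases hg with rfl | rfl
        · exact hrσ
        · exact hrα
      | one => exact r.refl
      | mul g h _ _ ihg ihh => exact fun x => r.trans (ihh x) (ihg (h x))
      | inv g _ ih => exact fun x => r.symm (by simpa using ih (g⁻¹ x))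
    have : Subsingleton (Quotient r) := ⟨fun p q => by
      induction p using Quotient.inductionOn with | _ x
      induction q using Quotient.inductionOn with | _ y
      obtain ⟨g, hg, rfl⟩ := htrans x y
      exact Quotient.sound (hrg g hg x)⟩
    have := (Finite.card_le_one_iff_subsingleton (α := Quotient r)).2 this
    omega
  · have hs := sign_mul σ α
    rw [sign_eq_neg_one_pow_numCycles, sign_eq_neg_one_pow_numCycles σ,
      sign_eq_neg_one_pow_numCycles α, ← pow_add, Units.ext_iff] at hs
    push_cast at hs
    simp only [neg_one_pow_eq_ite, Nat.even_iff] at hs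
    rw [Nat.ModEq]
    split_ifs at hs <;> omega
end
end

section
/- Let Δ be a finite set of even cardinality 2m with m ≥ 2, let σ be a permutation of Δ and α a fixed-point-free involution of Δ, suppose the subgroup generated by σ and α acts transitively on Δ, and suppose the ribbon graph (σ, α) is planar, i.e., c(σ) − m + c(σ∘α) = 2. Let d ∈ Δ be such that σ(d) ≠ d, σ(α(d)) ≠ α(d), and d and α(d) lie in the same cycle of σ∘α (the two sides of the edge {d, α(d)} belong to the same face). Delete the edge {d, α(d)}: set Δ' := Δ ∖ {d, α(d)}, let α' be the restriction of α to Δ', and let σ' be the permutation of Δ' sending x to the first element of the sequence σ(x), σ²(x), σ³(x), … that does not lie in {d, α(d)}. Then the subgroup generated by σ' and α' has exactly two orbits Δ_1, Δ_2 on Δ', and each resulting connected ribbon graph is planar: c(σ'|Δ_i) − |Δ_i|/2 + c((σ'∘α')|Δ_i) = 2 for i = 1, 2. -/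
noncomputable section

/-- The orbit of `x` under the subgroup generated by `σ` and `α`. -/
def componentOf {B : Type*} (σ α : Equiv.Perm B) (x : B) : Set B :=
  {y | ∃ g ∈ Subgroup.closure ({σ, α} : Set (Equiv.Perm B)), g x = y}

/-- The rational functions supported on `s` and invariant under `π`. -/
def invariantFunctions {B : Type*} (π : Equiv.Perm B) (s : Set B) : Submodule ℚ (B → ℚ) where
  carrier := {f | (∀ x, f (π x) = f x) ∧ ∀ x, x ∉ s → f x = 0}
  zero_mem' := ⟨fun _ => rfl, fun _ _ => rfl⟩
  add_mem' := by
    rintro f g ⟨hf, hf'⟩ ⟨hg, hg'⟩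
    exact ⟨fun x => by simp [hf, hg], fun x hx => by simp [hf' x hx, hg' x hx]⟩
  smul_mem' := by
    rintro c f ⟨hf, hf'⟩
    exact ⟨fun x => by simp [hf], fun x hx => by simp [hf' x hx]⟩

theorem apply_eq_of_sameCycle {B C : Type*} [Finite B] {π : Equiv.Perm B} {f : B → C}
    (hf : ∀ x, f (π x) = f x) {x y : B} (h : π.SameCycle x y) : f x = f y := by
  obtain ⟨n, rfl⟩ := h.exists_nat_pow_eq
  clear h
  induction n with
  | zero => rfl
  | succ n ih => rw [pow_succ', Equiv.Perm.mul_apply, hf, ih]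

theorem cycleSet_eq_iff {B : Type*} {π : Equiv.Perm B} {x y : B} :
    cycleSet π x = cycleSet π y ↔ π.SameCycle x y := by
  refine ⟨fun h => ?_, fun h => ?_⟩
  · have : y ∈ cycleSet π x := by rw [h]; exact Equiv.Perm.SameCycle.refl π y
    exact this
  · ext z
    exact ⟨fun hz => h.symm.trans hz, fun hz => h.trans hz⟩

/-- The number of cycles of `π` in a `π`-invariant set is the dimension of the space of
`π`-invariant functions supported on that set. -/
theorem finrank_invariantFunctions {B : Type*} [Finite B] (π : Equiv.Perm B) (s : Set B)
    (hs : ∀ x, π x ∈ s ↔ x ∈ s) :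
    Module.finrank ℚ (invariantFunctions π s) = numCyclesIn π s := by
  classical
  have : Fintype (cyclesIn π s) := Fintype.ofFinite _
  let Φ : (cyclesIn π s → ℚ) →ₗ[ℚ] (B → ℚ) :=
    { toFun := fun f x => if h : x ∈ s then f ⟨cycleSet π x, x, h, rfl⟩ else 0
      map_add' := by
        intro f g
        ext x
        by_cases h : x ∈ s <;> simp [h]
      map_smul' := by
        intro c f
        ext x
        by_cases h : x ∈ s <;> simp [h] }
  have hinj : Function.Injective Φ := by
    intro f g hfg
    ext ⟨t, b, hb, rfl⟩
    simpa [Φ, hb] using congrFun hfg b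
  have hrange : LinearMap.range Φ = invariantFunctions π s := by
    ext f
    constructor
    · rintro ⟨g, rfl⟩
      refine ⟨fun x => ?_, fun x hx => by simp [Φ, hx]⟩
      have hc : cycleSet π (π x) = cycleSet π x :=
        cycleSet_eq_iff.2 (Equiv.Perm.sameCycle_apply_left.2 (Equiv.Perm.SameCycle.refl π x))
      by_cases h : x ∈ s <;> simp [Φ, hs, h, hc]
    · rintro ⟨hf, hf'⟩
      refine ⟨fun t => f t.2.choose, ?_⟩
      ext x
      by_cases h : x ∈ s
      · have hx : cycleSet π x ∈ cyclesIn π s := ⟨x, h, rfl⟩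
        have := apply_eq_of_sameCycle hf (cycleSet_eq_iff.1 hx.choose_spec.2)
        simp [Φ, h, this]
      · simp [Φ, h, hf' x h]
  rw [← hrange, LinearMap.finrank_range_of_inj hinj, Module.finrank_fintype_fun_eq_card,
    numCyclesIn, Nat.card_eq_fintype_card]

theorem mem_componentOf_self {B : Type*} (σ τ : Equiv.Perm B) (b : B) :
    b ∈ componentOf σ τ b :=
  ⟨1, one_mem _, rfl⟩

theorem apply_mem_componentOf {B : Type*} {σ τ g : Equiv.Perm B}
    (hg : g ∈ Subgroup.closure ({σ, τ} : Set (Equiv.Perm B))) (b x : B) :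
    g x ∈ componentOf σ τ b ↔ x ∈ componentOf σ τ b := by
  constructor
  · rintro ⟨h, hh, hx⟩
    exact ⟨g⁻¹ * h, mul_mem (inv_mem hg) hh, by simp [hx]⟩
  · rintro ⟨h, hh, rfl⟩
    exact ⟨g * h, mul_mem hg hh, rfl⟩

theorem left_mem_closure_pair {G : Type*} [Group G] (a b : G) :
    a ∈ Subgroup.closure ({a, b} : Set G) :=
  Subgroup.subset_closure (by simp)

theorem right_mem_closure_pair {G : Type*} [Group G] (a b : G) :
    b ∈ Subgroup.closure ({a, b} : Set G) :=
  Subgroup.subset_closure (by simp)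

theorem componentOf_eq_of_mem {B : Type*} {σ τ : Equiv.Perm B} {x y : B}
    (h : y ∈ componentOf σ τ x) : componentOf σ τ y = componentOf σ τ x := by
  obtain ⟨g, hg, rfl⟩ := h
  ext z
  constructor
  · rintro ⟨k, hk, rfl⟩
    exact ⟨k * g, mul_mem hk hg, rfl⟩
  · rintro ⟨k, hk, rfl⟩
    exact ⟨k * g⁻¹, mul_mem hk (inv_mem hg), by simp⟩

/-- A function invariant under two permutations is constant on the orbits of the group they
generate. -/
theorem apply_eq_of_mem_closure_pair {B C : Type*} {σ τ : Equiv.Perm B} {f : B → C}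
    (hσ : ∀ x, f (σ x) = f x) (hτ : ∀ x, f (τ x) = f x) {g : Equiv.Perm B}
    (hg : g ∈ Subgroup.closure ({σ, τ} : Set (Equiv.Perm B))) : ∀ x, f (g x) = f x := by
  induction hg using Subgroup.closure_induction with
  | mem g hg =>
    rcases hg with rfl | rfl
    exacts [hσ, hτ]
  | one => exact fun _ => rfl
  | mul g h _ _ ihg ihh => exact fun x => by rw [Equiv.Perm.mul_apply, ihg, ihh]
  | inv g _ ih => exact fun x => by simpa using (ih (g⁻¹ x)).symm

/-- The dimension of a space of functions which are supported on an orbit of the group generated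
by two permutations and invariant under both of them is at most one. -/
theorem finrank_le_one_of_invariant {B : Type*} {σ τ : Equiv.Perm B} (b : B)
    (K : Submodule ℚ (B → ℚ))
    (hσ : ∀ f ∈ K, ∀ x, f (σ x) = f x) (hτ : ∀ f ∈ K, ∀ x, f (τ x) = f x)
    (hs : ∀ f ∈ K, ∀ x, x ∉ componentOf σ τ b → f x = 0) :
    Module.finrank ℚ K ≤ 1 := by
  let ev : K →ₗ[ℚ] ℚ := (LinearMap.proj b).comp K.subtype
  have hinj : Function.Injective ev := by
    rw [injective_iff_map_eq_zero]
    rintro ⟨f, hf⟩ h0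
    ext x
    by_cases hx : x ∈ componentOf σ τ b
    · obtain ⟨g, hg, rfl⟩ := hx
      exact (apply_eq_of_mem_closure_pair (hσ f hf) (hτ f hf) hg b).trans h0
    · exact hs f hf x hx
  simpa using LinearMap.finrank_le_finrank_of_injective hinj

/-- The Riemann–Hurwitz (genus) inequality: on an orbit `s` of the group generated by `σ` and `τ`,
the permutations `σ`, `τ` and `σ * τ` have at most `|s| + 2` cycles altogether. -/
theorem numCyclesIn_componentOf_add_le {B : Type*} [Fintype B] (σ τ : Equiv.Perm B) (b : B) :
    numCyclesIn σ (componentOf σ τ b) + numCyclesIn τ (componentOf σ τ b) +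
      numCyclesIn (σ * τ) (componentOf σ τ b) ≤ Nat.card (componentOf σ τ b) + 2 := by
  classical
  have hσm := left_mem_closure_pair σ τ
  have hτm := right_mem_closure_pair σ τ
  rw [← finrank_invariantFunctions σ _ (apply_mem_componentOf hσm b),
    ← finrank_invariantFunctions τ _ (apply_mem_componentOf hτm b),
    ← finrank_invariantFunctions (σ * τ) _ (apply_mem_componentOf (mul_mem hσm hτm) b)]
  have hsσ := apply_mem_componentOf hσm b
  set s := componentOf σ τ b
  set U := invariantFunctions σ s
  set V := invariantFunctions τ s
  set X := invariantFunctions (σ * τ) s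
  let L : (B → ℚ) →ₗ[ℚ] (B → ℚ) := LinearMap.funLeft ℚ ℚ σ - LinearMap.id
  have hL : ∀ f x, L f x = f (σ x) - f x := fun f x => rfl
  let W : Submodule ℚ (B → ℚ) := invariantFunctions 1 s
  have hRW : X.map L ≤ W := by
    rintro _ ⟨f, ⟨-, hf⟩, rfl⟩
    refine ⟨fun _ => rfl, fun x hx => ?_⟩
    rw [hL, hf x hx, hf _ ((hsσ x).not.2 hx), sub_zero]
  have hUVW : U ⊔ V ≤ W :=
    sup_le (fun f hf => ⟨fun _ => rfl, hf.2⟩) (fun f hf => ⟨fun _ => rfl, hf.2⟩)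
  have hW : Module.finrank ℚ W ≤ Nat.card s := by
    let ρ : W →ₗ[ℚ] (s → ℚ) := (LinearMap.funLeft ℚ ℚ (Subtype.val : s → B)).comp W.subtype
    have hρ : Function.Injective ρ := by
      rw [injective_iff_map_eq_zero]
      rintro ⟨f, hf⟩ h0
      ext x
      by_cases hx : x ∈ s
      · exact congrFun h0 ⟨x, hx⟩
      · exact hf.2 x hx
    have := LinearMap.finrank_le_finrank_of_injective hρ
    rwa [Module.finrank_fintype_fun_eq_card, ← Nat.card_eq_fintype_card] at this
  have horth : ∀ f ∈ X, ∀ h ∈ U ⊔ V, ∑ x, h x * L f x = 0 := by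
    rintro f ⟨hf, -⟩ h hh
    obtain ⟨u, hu, v, hv, rfl⟩ := Submodule.mem_sup.1 hh
    have h1 : ∑ x, u x * f (σ x) = ∑ x, u x * f x := by
      rw [← Equiv.sum_comp σ (fun x => u x * f x)]
      exact Finset.sum_congr rfl fun x _ => by rw [hu.1]
    have h2 : ∑ x, v x * f (σ x) = ∑ x, v x * f x := by
      rw [← Equiv.sum_comp τ (fun x => v x * f (σ x))]
      exact Finset.sum_congr rfl fun x _ => by rw [hv.1, ← hf x]; rfl
    simp only [hL, Pi.add_apply, add_mul, mul_sub, Finset.sum_add_distrib, Finset.sum_sub_distrib,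
      h1, h2, sub_self]
  have hdisj : X.map L ⊓ (U ⊔ V) = ⊥ := by
    rw [eq_bot_iff]
    rintro _ ⟨⟨f, hf, rfl⟩, hfUV⟩
    have h0 := horth f hf _ hfUV
    rw [Finset.sum_eq_zero_iff_of_nonneg fun x _ => mul_self_nonneg _] at h0
    rw [Submodule.mem_bot]
    ext x
    exact mul_self_eq_zero.1 (h0 x (Finset.mem_univ x))
  have e1 := Submodule.finrank_sup_add_finrank_inf_eq (X.map L) (U ⊔ V)
  rw [hdisj, finrank_bot, add_zero] at e1
  have e2 := Submodule.finrank_mono (sup_le hRW hUVW)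
  have e3 := Submodule.finrank_sup_add_finrank_inf_eq U V
  have e4 : Module.finrank ℚ (U ⊓ V : Submodule ℚ (B → ℚ)) ≤ 1 :=
    finrank_le_one_of_invariant (σ := σ) (τ := τ) b _ (fun f hf => hf.1.1) (fun f hf => hf.2.1)
      (fun f hf => hf.1.2)
  have e5 := (L.comp X.subtype).finrank_range_add_finrank_ker
  rw [LinearMap.range_comp, Submodule.range_subtype, ← Submodule.finrank_map_subtype_eq] at e5
  have e6 : Module.finrank ℚ ((LinearMap.ker (L.comp X.subtype)).map X.subtype) ≤ 1 := by
    have hk : ∀ f ∈ (LinearMap.ker (L.comp X.subtype)).map X.subtype, ∀ x, f (σ x) = f x := by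
      rintro _ ⟨f, hf, rfl⟩ x
      exact sub_eq_zero.1 (congrFun hf x)
    have hX := Submodule.map_subtype_le X (LinearMap.ker (L.comp X.subtype))
    refine finrank_le_one_of_invariant (σ := σ) (τ := τ) b _ hk (fun f hf x => ?_)
      (fun f hf => (hX hf).2)
    rw [← hk f hf (τ x)]
    exact (hX hf).1 x
  omega

theorem card_le_two_mul_numCyclesIn {B : Type*} [Finite B] {α : Equiv.Perm B}
    (hα : ∀ x, α (α x) = x) (s : Set B) : Nat.card s ≤ 2 * numCyclesIn α s := by
  classical
  have := Fintype.ofFinite B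
  have himg : cyclesIn α s = ((s.toFinset.image (cycleSet α) : Finset (Set B)) : Set (Set B)) := by
    ext t
    simp [cyclesIn, eq_comm]
  rw [numCyclesIn, himg, Nat.card_eq_fintype_card, ← Set.toFinset_card, Nat.card_coe_set_eq,
    Set.ncard_coe_finset]
  refine Finset.card_le_mul_card_image _ 2 fun t ht => ?_
  obtain ⟨b, -, rfl⟩ := Finset.mem_image.1 ht
  refine (Finset.card_le_card (t := {b, α b}) fun x hx => ?_).trans Finset.card_le_two
  obtain ⟨n, rfl⟩ := (cycleSet_eq_iff.1 (Finset.mem_filter.1 hx).2).symm.exists_nat_pow_eq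
  clear hx ht
  induction n with
  | zero => simp
  | succ n ih =>
    rw [pow_succ', Equiv.Perm.mul_apply]
    rcases Finset.mem_insert.1 ih with h | h
    · simp [h]
    · simp [Finset.mem_singleton.1 h, hα]

/-- The Euler characteristic of a connected ribbon graph is at most two. -/
theorem two_mul_numCyclesIn_componentOf_le {B : Type*} [Fintype B] (σ : Equiv.Perm B)
    {α : Equiv.Perm B} (hα : ∀ x, α (α x) = x) (b : B) :
    2 * numCyclesIn σ (componentOf σ α b) + 2 * numCyclesIn (σ * α) (componentOf σ α b) ≤
      Nat.card (componentOf σ α b) + 4 := by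
  have h1 := numCyclesIn_componentOf_add_le σ α b
  have h2 := card_le_two_mul_numCyclesIn hα (componentOf σ α b)
  omega

theorem finrank_invariantFunctions_univ {B : Type*} [Finite B] (π : Equiv.Perm B) :
    Module.finrank ℚ (invariantFunctions π Set.univ) = numCycles π :=
  finrank_invariantFunctions π _ fun _ => by simp

/-- Restriction of invariant functions to a subtype that meets every cycle. -/
theorem exists_injective_restriction {B : Type*} {p : B → Prop} {π : Equiv.Perm B}
    {π' : Equiv.Perm {x // p x}}
    (hπ' : ∀ f ∈ invariantFunctions π Set.univ, ∀ x : {x // p x}, f (π' x) = f x)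
    (hp : ∀ x, p x ∨ p (π x)) :
    ∃ r : invariantFunctions π Set.univ →ₗ[ℚ] invariantFunctions π' Set.univ,
      Function.Injective r ∧ ∀ f x, (r f : {x // p x} → ℚ) x = (f : B → ℚ) x := by
  let r : invariantFunctions π Set.univ →ₗ[ℚ] invariantFunctions π' Set.univ :=
    ((LinearMap.funLeft ℚ ℚ (Subtype.val : {x // p x} → B)).comp
      (invariantFunctions π Set.univ).subtype).codRestrict _
      fun f => ⟨hπ' f f.2, fun x hx => (hx trivial).elim⟩
  have hr : ∀ f x, (r f : {x // p x} → ℚ) x = (f : B → ℚ) x := fun _ _ => rfl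
  refine ⟨r, ?_, hr⟩
  rw [injective_iff_map_eq_zero]
  rintro f h0
  have h0' : ∀ x, p x → (f : B → ℚ) x = 0 := fun x hx => by
    rw [← hr f ⟨x, hx⟩, h0]
    rfl
  ext x
  rcases hp x with h | h
  · exact h0' x h
  · rw [← f.2.1 x]
    exact h0' _ h

/-- If `e` and `d` lie on the same cycle of `φ`, then `φ'`, obtained from `φ` by closing up the two
arcs between `d` and `e`, separates these arcs. -/
theorem not_sameCycle_of_split {B : Type*} [Finite B] {d e : B} {φ : Equiv.Perm B}
    {φ' : Equiv.Perm {x : B // x ≠ d ∧ x ≠ e}} (hne : d ≠ e) (hde : φ.SameCycle d e)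
    (hφ' : ∀ x : {x : B // x ≠ d ∧ x ≠ e}, φ x ≠ d → φ x ≠ e → (φ' x : B) = φ x)
    (hφe : ∀ x : {x : B // x ≠ d ∧ x ≠ e}, φ x = e → (φ' x : B) = φ d)
    {x y : {x : B // x ≠ d ∧ x ≠ e}} (hx : (x : B) = φ d) (hy : (y : B) = φ e) :
    ¬ φ'.SameCycle x y := by
  classical
  have hex : ∃ n : ℕ, (φ ^ n) d = e := hde.exists_nat_pow_eq
  let k := Nat.find hex
  have hk : (φ ^ k) d = e := Nat.find_spec hex
  have hmin : ∀ i, i < k → (φ ^ i) d ≠ e := fun i hi => Nat.find_min hex hi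
  have hstep : ∀ i, φ ((φ ^ i) d) = (φ ^ (i + 1)) d := fun i => by
    rw [pow_succ', Equiv.Perm.mul_apply]
  have hd : ∀ i, 0 < i → i < k → (φ ^ i) d ≠ d := by
    intro i hi hik h
    refine hmin (k - i) (by omega) ?_
    rw [← hk]
    conv_rhs => rw [← Nat.sub_add_cancel hik.le, pow_add, Equiv.Perm.mul_apply, h]
  have hk1 : 1 < k := by
    rcases Nat.lt_or_ge 1 k with h | h
    · exact h
    · interval_cases hk' : k
      · exact (hne hk).elim
      · exact (x.2.2 (hx.trans hk)).elim
  have hA : ∀ n : ℕ, ∃ i, 0 < i ∧ i < k ∧ (((φ' ^ n) x : {x : B // x ≠ d ∧ x ≠ e}) : B) =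
      (φ ^ i) d := by
    intro n
    induction n with
    | zero => exact ⟨1, one_pos, hk1, hx⟩
    | succ n ih =>
      obtain ⟨i, hi, hik, h⟩ := ih
      rw [pow_succ', Equiv.Perm.mul_apply]
      rcases Nat.lt_or_ge (i + 1) k with hlt | hge
      · refine ⟨i + 1, i.succ_pos, hlt, ?_⟩
        rw [hφ', h, hstep]
        · rw [h, hstep]
          exact hd _ i.succ_pos hlt
        · rw [h, hstep]
          exact hmin _ hlt
      · refine ⟨1, one_pos, hk1, ?_⟩
        rw [hφe, pow_one]
        rw [h, hstep, show i + 1 = k by omega, hk]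
  intro hxy
  obtain ⟨n, rfl⟩ := hxy.exists_nat_pow_eq
  obtain ⟨i, hi, hik, h⟩ := hA n
  obtain ⟨j, rfl⟩ : ∃ j, i = j + 1 := ⟨i - 1, by omega⟩
  rw [hy, ← hstep] at h
  exact hmin j (by omega) (φ.injective h).symm

theorem numCycles_le_add_of_union {B : Type*} [Finite B] (π : Equiv.Perm B) {s t : Set B}
    (h : s ∪ t = Set.univ) : numCycles π ≤ numCyclesIn π s + numCyclesIn π t := by
  have : cyclesIn π Set.univ = cyclesIn π s ∪ cyclesIn π t := by
    ext c
    constructor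
    · rintro ⟨b, -, rfl⟩
      rcases (h ▸ Set.mem_univ b : b ∈ s ∪ t) with hb | hb
      exacts [Or.inl ⟨b, hb, rfl⟩, Or.inr ⟨b, hb, rfl⟩]
    · rintro (⟨b, -, rfl⟩ | ⟨b, -, rfl⟩) <;> exact ⟨b, trivial, rfl⟩
  rw [numCycles, numCyclesIn, this]
  exact Set.ncard_union_le _ _

/-- Deleting, from a planar ribbon graph `(σ, α)` on `2m ≥ 4` darts, a non-self-loop
edge `{d, α d}` whose two sides lie in the same face: the remaining darts
`Δ' = Δ \ {d, α d}`, with `α'` the restriction of `α` and `σ'` sending `x` to the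
first of `σ x, σ² x, σ³ x, …` not in `{d, α d}`, form exactly two connected
components, and each resulting connected ribbon graph is planar:
`c(σ'|Δᵢ) - |Δᵢ|/2 + c((σ'∘α')|Δᵢ) = 2` (stated multiplied by `2`). -/
theorem planar_ribbon_graph_face_splitting_edge_deletion (Δ : Type) [Fintype Δ]
    [DecidableEq Δ] (m : ℕ) (hm : 2 ≤ m) (hcard : Fintype.card Δ = 2 * m)
    (σ α : Equiv.Perm Δ)
    (hinv : ∀ x, α (α x) = x) (hfree : ∀ x, α x ≠ x)
    (htrans : ∀ x y : Δ,
      ∃ g ∈ Subgroup.closure ({σ, α} : Set (Equiv.Perm Δ)), g x = y)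
    (hplanar : numCycles σ + numCycles (σ * α) = m + 2)
    (d : Δ) (hd1 : σ d ≠ d) (hd2 : σ (α d) ≠ α d)
    (hd3 : (σ * α).SameCycle d (α d))
    (σ' α' : Equiv.Perm {x : Δ // x ≠ d ∧ x ≠ α d})
    (hα' : ∀ x : {x : Δ // x ≠ d ∧ x ≠ α d}, ((α' x : Δ) = α (x : Δ)))
    (hσ' : ∀ x : {x : Δ // x ≠ d ∧ x ≠ α d},
      ((σ' x : Δ) =
        if σ (x : Δ) ≠ d ∧ σ (x : Δ) ≠ α d then σ (x : Δ)
        else if σ (σ (x : Δ)) ≠ d ∧ σ (σ (x : Δ)) ≠ α d then σ (σ (x : Δ))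
        else σ (σ (σ (x : Δ))))) :
    ∃ Δ₁ Δ₂ : Set {x : Δ // x ≠ d ∧ x ≠ α d}, Δ₁ ≠ Δ₂ ∧
      {s | ∃ x, s = componentOf σ' α' x} = {Δ₁, Δ₂} ∧
      2 * numCyclesIn σ' Δ₁ + 2 * numCyclesIn (σ' * α') Δ₁ = Nat.card Δ₁ + 4 ∧
      2 * numCyclesIn σ' Δ₂ + 2 * numCyclesIn (σ' * α') Δ₂ = Nat.card Δ₂ + 4 := by
  revert σ' α'
  generalize he : α d = e at hd2 hd3 ⊢
  intro σ' α' hα' hσ'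
  have hne : d ≠ e := he ▸ (hfree d).symm
  have hαe : α e = d := he ▸ hinv d
  have hφd : (σ * α) d = σ e := by rw [Equiv.Perm.mul_apply, he]
  have hφe : (σ * α) e = σ d := by rw [Equiv.Perm.mul_apply, hαe]
  have hde : σ d ≠ e := by
    intro h
    rw [h] at hφe
    exact hne ((hd3.symm.eq_of_left hφe).symm)
  have hed : σ e ≠ d := fun h => hne (hd3.eq_of_left (hφd.trans h))
  have hσ1 : ∀ x : {x : Δ // x ≠ d ∧ x ≠ e}, σ x ≠ d → σ x ≠ e → (σ' x : Δ) = σ x :=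
    fun x h1 h2 => by rw [hσ', if_pos ⟨h1, h2⟩]
  have hσd : ∀ x : {x : Δ // x ≠ d ∧ x ≠ e}, σ x = d → (σ' x : Δ) = σ d := fun x h => by
    rw [hσ', h, if_neg (by simp), if_pos ⟨hd1, hde⟩]
  have hσe : ∀ x : {x : Δ // x ≠ d ∧ x ≠ e}, σ x = e → (σ' x : Δ) = σ e := fun x h => by
    rw [hσ', h, if_neg (by simp), if_pos ⟨hed, hd2⟩]
  have hφ1 : ∀ x : {x : Δ // x ≠ d ∧ x ≠ e}, (σ * α) x ≠ d → (σ * α) x ≠ e →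
      ((σ' * α') x : Δ) = (σ * α) x := by
    intro x h1 h2
    rw [Equiv.Perm.mul_apply, hσ1 _ (by rwa [hα']) (by rwa [hα']), hα']
    rfl
  have hφd' : ∀ x : {x : Δ // x ≠ d ∧ x ≠ e}, (σ * α) x = d → ((σ' * α') x : Δ) = (σ * α) e := by
    intro x h
    rw [Equiv.Perm.mul_apply, hσd _ (by rwa [hα']), hφe]
  have hφe' : ∀ x : {x : Δ // x ≠ d ∧ x ≠ e}, (σ * α) x = e → ((σ' * α') x : Δ) = (σ * α) d := by
    intro x h
    rw [Equiv.Perm.mul_apply, hσe _ (by rwa [hα']), hφd]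
  let u : {x : Δ // x ≠ d ∧ x ≠ e} := ⟨σ d, hd1, hde⟩
  let v : {x : Δ // x ≠ d ∧ x ≠ e} := ⟨σ e, hed, hd2⟩
  -- Vertices are preserved and the face through the edge splits.
  have hcσ : numCycles σ ≤ numCycles σ' := by
    rw [← finrank_invariantFunctions_univ, ← finrank_invariantFunctions_univ]
    obtain ⟨r, hr, -⟩ := exists_injective_restriction (π := σ) (π' := σ')
      (fun f hf x => by
        by_cases h1 : σ x = d
        · rw [hσd x h1, hf.1, ← hf.1 x, h1]
        by_cases h2 : σ x = e
        · rw [hσe x h2, hf.1, ← hf.1 x, h2]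
        rw [hσ1 x h1 h2, hf.1])
      (fun x => by
        by_cases h1 : x = d
        · exact Or.inr (by rw [h1]; exact ⟨hd1, hde⟩)
        by_cases h2 : x = e
        · exact Or.inr (by rw [h2]; exact ⟨hed, hd2⟩)
        exact Or.inl ⟨h1, h2⟩)
    exact LinearMap.finrank_le_finrank_of_injective hr
  have hcφ : numCycles (σ * α) < numCycles (σ' * α') := by
    rw [← finrank_invariantFunctions_univ, ← finrank_invariantFunctions_univ]
    obtain ⟨r, hr, hr'⟩ := exists_injective_restriction (π := σ * α) (π' := σ' * α')
      (fun f hf x => by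
        have hfde : f d = f e := apply_eq_of_sameCycle hf.1 hd3
        by_cases h1 : (σ * α) x = d
        · rw [hφd' x h1, hf.1, ← hf.1 x, h1, hfde]
        by_cases h2 : (σ * α) x = e
        · rw [hφe' x h2, hf.1, ← hf.1 x, h2, hfde]
        rw [hφ1 x h1 h2, hf.1])
      (fun x => by
        by_cases h1 : x = d
        · exact Or.inr (by rw [h1, hφd]; exact ⟨hed, hd2⟩)
        by_cases h2 : x = e
        · exact Or.inr (by rw [h2, hφe]; exact ⟨hd1, hde⟩)
        exact Or.inl ⟨h1, h2⟩)
    rw [← LinearMap.finrank_range_of_inj hr]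
    refine Submodule.finrank_lt fun htop => ?_
    have hvu : ¬ (σ' * α').SameCycle v u :=
      not_sameCycle_of_split hne hd3 hφ1 hφe' hφd.symm hφe.symm
    let g : {x : Δ // x ≠ d ∧ x ≠ e} → ℚ := Set.indicator (cycleSet (σ' * α') v) 1
    have hg : g ∈ invariantFunctions (σ' * α') Set.univ := by
      refine ⟨fun x => ?_, fun x hx => (hx trivial).elim⟩
      have : (σ' * α') x ∈ cycleSet (σ' * α') v ↔ x ∈ cycleSet (σ' * α') v :=
        Equiv.Perm.sameCycle_apply_right
      by_cases hx : x ∈ cycleSet (σ' * α') v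
      · simp only [g, Set.indicator_of_mem hx, Set.indicator_of_mem (this.2 hx), Pi.one_apply]
      · simp only [g, Set.indicator_of_notMem hx, Set.indicator_of_notMem (this.not.2 hx)]
    obtain ⟨f, hf⟩ : (⟨g, hg⟩ : invariantFunctions (σ' * α') Set.univ) ∈ LinearMap.range r :=
      htop ▸ Submodule.mem_top
    have hfg : ∀ x : {x : Δ // x ≠ d ∧ x ≠ e}, (f : Δ → ℚ) x = g x := fun x => by
      rw [← hr' f x, hf]
    have h1 : g v = 1 := by
      have hv : v ∈ cycleSet (σ' * α') v := Equiv.Perm.SameCycle.refl _ v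
      simp only [g, Set.indicator_of_mem hv, Pi.one_apply]
    have h0 : g u = 0 := Set.indicator_of_notMem (s := cycleSet (σ' * α') v) hvu 1
    have huv : (f : Δ → ℚ) (σ e) = (f : Δ → ℚ) (σ d) := by
      rw [← hφd, ← hφe, f.2.1, f.2.1]
      exact apply_eq_of_sameCycle f.2.1 hd3
    rw [← hfg] at h0 h1
    exact one_ne_zero (h1.symm.trans (huv.trans h0))
  -- The endpoints of the deleted edge meet every component.
  have hcover : componentOf σ' α' u ∪ componentOf σ' α' v = Set.univ := by
    set T := componentOf σ' α' u ∪ componentOf σ' α' v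
    let S : Set Δ := {y | ∀ h : y ≠ d ∧ y ≠ e, (⟨y, h⟩ : {x : Δ // x ≠ d ∧ x ≠ e}) ∈ T}
    have hTg : ∀ g ∈ Subgroup.closure ({σ', α'} : Set (Equiv.Perm {x : Δ // x ≠ d ∧ x ≠ e})),
        ∀ x, g x ∈ T ↔ x ∈ T := fun g hg x =>
      or_congr (apply_mem_componentOf hg u x) (apply_mem_componentOf hg v x)
    have hSσ : ∀ y, y ∈ S → σ y ∈ S := by
      intro y hy h
      by_cases h1 : y = d
      · subst h1
        exact Or.inl (mem_componentOf_self σ' α' u)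
      by_cases h2 : y = e
      · subst h2
        exact Or.inr (mem_componentOf_self σ' α' v)
      have := (hTg _ (left_mem_closure_pair σ' α') _).2 (hy ⟨h1, h2⟩)
      rwa [show σ' ⟨y, h1, h2⟩ = ⟨σ y, h⟩ from Subtype.ext (hσ1 ⟨y, h1, h2⟩ h.1 h.2)] at this
    have hSα : ∀ y, y ∈ S → α y ∈ S := by
      intro y hy h
      have h1 : y ≠ d := fun h1 => h.2 (by rw [h1, he])
      have h2 : y ≠ e := fun h2 => h.1 (by rw [h2, hαe])
      have := (hTg _ (right_mem_closure_pair σ' α') _).2 (hy ⟨h1, h2⟩)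
      rwa [show α' ⟨y, h1, h2⟩ = ⟨α y, h⟩ from Subtype.ext (hα' ⟨y, h1, h2⟩)] at this
    have hiff : ∀ π : Equiv.Perm Δ, (∀ y, y ∈ S → π y ∈ S) → ∀ y, (π y ∈ S) = (y ∈ S) := by
      intro π hπ y
      refine propext ⟨fun h => ?_, hπ y⟩
      simpa using Equiv.Perm.perm_symm_mapsTo_of_mapsTo π (s := S) hπ h
    refine Set.eq_univ_of_forall fun x => ?_
    obtain ⟨g, hg, hx⟩ := htrans d x
    have hdS : d ∈ S := fun h => (h.1 rfl).elim
    have hxS : (x : Δ) ∈ S := by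
      rw [← hx]
      exact (apply_eq_of_mem_closure_pair (f := fun y => y ∈ S) (hiff σ hSσ) (hiff α hSα) hg d).mpr
        hdS
    exact hxS x.2
  have hα'' : ∀ x, α' (α' x) = x := fun x => Subtype.ext (by rw [hα', hα', hinv])
  have hcard' : Nat.card {x : Δ // x ≠ d ∧ x ≠ e} + 2 = 2 * m := by
    rw [← hcard, Nat.card_eq_fintype_card, Fintype.card_subtype]
    have : (Finset.univ.filter fun x : Δ => x ≠ d ∧ x ≠ e) = ({d, e} : Finset Δ)ᶜ := by
      ext x
      simp
    rw [this, Finset.card_compl, Finset.card_pair hne]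
    omega
  have hu := two_mul_numCyclesIn_componentOf_le σ' hα'' u
  have hv := two_mul_numCyclesIn_componentOf_le σ' hα'' v
  have hneq : componentOf σ' α' u ≠ componentOf σ' α' v := by
    intro h
    rw [← h, Set.union_self] at hcover
    rw [hcover, Nat.card_univ] at hu
    change 2 * numCycles σ' + 2 * numCycles (σ' * α') ≤ _ at hu
    omega
  have hdisj : Disjoint (componentOf σ' α' u) (componentOf σ' α' v) := by
    rw [Set.disjoint_left]
    intro x hxu hxv
    exact hneq ((componentOf_eq_of_mem hxu).symm.trans (componentOf_eq_of_mem hxv))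
  have hsum : Nat.card (componentOf σ' α' u) + Nat.card (componentOf σ' α' v) =
      Nat.card {x : Δ // x ≠ d ∧ x ≠ e} := by
    have := Set.ncard_union_eq hdisj
    rw [hcover, Set.ncard_univ] at this
    exact this.symm
  have hσsum := numCycles_le_add_of_union σ' hcover
  have hφsum := numCycles_le_add_of_union (σ' * α') hcover
  refine ⟨componentOf σ' α' u, componentOf σ' α' v, hneq, ?_, by omega, by omega⟩
  ext s
  constructor
  · rintro ⟨x, rfl⟩
    rcases (hcover ▸ Set.mem_univ x : x ∈ componentOf σ' α' u ∪ componentOf σ' α' v) with hx | hx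
    exacts [Or.inl (componentOf_eq_of_mem hx), Or.inr (componentOf_eq_of_mem hx)]
  · rintro (rfl | rfl)
    exacts [⟨u, rfl⟩, ⟨v, rfl⟩]
end
end
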